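/- For each integer k ≥ 2 there exists a real constant λ_k such that t_n/(n·R_n) → λ_k as n → ∞, and moreover lim_{k→∞} λ_k = 1; that is, the number of transitions of the Glushkov automaton of a uniformly random expression of REna of size n is asymptotically λ_k·n, with λ_k tending to 1 as the alphabet size grows. -/

import Mathlib

open Filter Set

/-- Regular expressions over an alphabet `A` (grammar β := ε | σ | β+β | β·β | β⋆). -/
inductive RegEx (A : Type) : Type where
  | eps : RegEx A
  | char (a : A) : RegEx A
  | plus (l r : RegEx A) : RegEx A
  | cat (l r : RegEx A) : RegEx A
  | star (e : RegEx A) : RegEx A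

namespace RegEx

/-- The (tree-)size of an expression: number of symbols / syntax-tree nodes. -/
def size {A : Type} : RegEx A → ℕ
  | eps => 1
  | char _ => 1
  | plus l r => size l + size r + 1
  | cat l r => size l + size r + 1
  | star e => size e + 1

/-- The number of letter occurrences (alphabetic size). -/
def letters {A : Type} : RegEx A → ℕ
  | eps => 0
  | char _ => 1
  | plus l r => letters l + letters r
  | cat l r => letters l + letters r
  | star e => letters e

/-- `IsUnionOfLetters e l` : `e` is a binary union tree whose leaves are single letters,
read from left to right giving the list `l`. -/
inductive IsUnionOfLetters {A : Type} : RegEx A → List A → Prop where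
  | char (a : A) : IsUnionOfLetters (char a) [a]
  | plus {l r : RegEx A} {ll rl : List A} :
      IsUnionOfLetters l ll → IsUnionOfLetters r rl →
      IsUnionOfLetters (plus l r) (ll ++ rl)

/-- `e` is of the form `(σ_{i₁}+⋯+σ_{i_k})⋆` where `σ_{i₁},…,σ_{i_k}` is a permutation of
the (finite) alphabet `A`. -/
def IsSigmaStar {A : Type} [Fintype A] (e : RegEx A) : Prop :=
  ∃ (f : RegEx A) (l : List A),
    e = star f ∧ IsUnionOfLetters f l ∧ l.Nodup ∧ ∀ a : A, a ∈ l

/-- The absorbing pattern `Σ⋆` does not occur in `e` as an argument of a union. -/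
def Avoids {A : Type} [Fintype A] : RegEx A → Prop
  | eps => True
  | char _ => True
  | plus l r => Avoids l ∧ Avoids r ∧ ¬ IsSigmaStar l ∧ ¬ IsSigmaStar r
  | cat l r => Avoids l ∧ Avoids r
  | star e => Avoids e

end RegEx

/-- Number of expressions in `REna` (over a `k`-letter alphabet) of size `n`. -/
noncomputable def Rcount (k n : ℕ) : ℕ :=
  Nat.card {e : RegEx (Fin k) // RegEx.Avoids e ∧ RegEx.size e = n}

/-- Number of all regular expressions (over a `k`-letter alphabet) of size `n`. -/
noncomputable def Bcount (k n : ℕ) : ℕ :=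
  Nat.card {e : RegEx (Fin k) // RegEx.size e = n}

/-- Total number of letter occurrences over all expressions in `REna` of size `n`. -/
noncomputable def Lcount (k n : ℕ) : ℕ :=
  Nat.card {p : RegEx (Fin k) × ℕ //
    RegEx.Avoids p.1 ∧ RegEx.size p.1 = n ∧ p.2 < RegEx.letters p.1}

/-- `C_k = (2k-2)!/(k-1)!` as a real number. -/
noncomputable def Cc (k : ℕ) : ℝ :=
  ((2 * k - 2).factorial : ℝ) / ((k - 1).factorial : ℝ)

/-- `p_k(z) = 1 − 2z − (7+8k)z²`. -/
noncomputable def Pp (k : ℕ) (z : ℝ) : ℝ := 1 - 2 * z - (7 + 8 * k) * z ^ 2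

/-- `h_k(z) = 1 − z − C_k·z^{2k+1}`. -/
noncomputable def Hh (k : ℕ) (z : ℝ) : ℝ := 1 - z - Cc k * z ^ (2 * k + 1)

/-- `Δ_k(z) = p_k(z) + 4·C_k·z^{2k+1}·h_k(z)`. -/
noncomputable def Dd (k : ℕ) (z : ℝ) : ℝ :=
  Pp k z + 4 * Cc k * z ^ (2 * k + 1) * Hh k z

/-- `g_k(z) = 2 − C_k·z^{2k−1}·(h_k(z) − C_k·z^{2k−1})`. -/
noncomputable def Gg (k : ℕ) (z : ℝ) : ℝ :=
  2 - Cc k * z ^ (2 * k - 1) * (Hh k z - Cc k * z ^ (2 * k - 1))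

/-- `ρ_k = 1/(1+√(8+8k))`, the positive root of `p_k`. -/
noncomputable def rho (k : ℕ) : ℝ := 1 / (1 + Real.sqrt (8 + 8 * k))

/-- `ψ_k(x) = −x·Δ_k′(x)`. -/
noncomputable def psi (k : ℕ) (x : ℝ) : ℝ := -x * deriv (Dd k) x

/-- `η` is a root of `Δ_k` in the interval `(0, 1/√(8+8k))`, and is the unique such root. -/
def IsEta (k : ℕ) (η : ℝ) : Prop :=
  η ∈ Set.Ioo (0 : ℝ) (1 / Real.sqrt (8 + 8 * k)) ∧ Dd k η = 0 ∧
    ∀ x ∈ Set.Ioo (0 : ℝ) (1 / Real.sqrt (8 + 8 * k)), Dd k x = 0 → x = η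

namespace RegEx

/-- The language of a regular expression (`ε` ↦ `{[]}`, `σ` ↦ `{[σ]}`, `+` ↦ union,
`·` ↦ concatenation, `⋆` ↦ Kleene star). -/
def lang {A : Type} : RegEx A → Language A
  | eps => 1
  | char a => {[a]}
  | plus l r => lang l + lang r
  | cat l r => lang l * lang r
  | star e => KStar.kstar (lang e)

/-- Mark each letter occurrence with its position (positions numbered consecutively from
`n+1`, left to right); returns the marked expression and the next position counter. -/
def markAux {A : Type} : RegEx A → ℕ → RegEx (A × ℕ) × ℕ
  | eps, n => (eps, n)
  | char a, n => (char (a, n + 1), n + 1)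
  | plus l r, n =>
      let (l', n') := markAux l n
      let (r', n'') := markAux r n'
      (plus l' r', n'')
  | cat l r, n =>
      let (l', n') := markAux l n
      let (r', n'') := markAux r n'
      (cat l' r', n'')
  | star e, n =>
      let (e', n') := markAux e n
      (star e', n')

/-- The marked expression `\bar e`, with letters marked by positions `1,…,|e|_Σ`. -/
def mark {A : Type} (e : RegEx A) : RegEx (A × ℕ) := (markAux e 0).1

/-- `First(e)`: the marked letters (positions) that can begin a word of the language of the
marked expression. -/
def First {A : Type} (e : RegEx A) : Set (A × ℕ) :=
  {x | ∃ w : List (A × ℕ), x :: w ∈ lang (mark e)}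

/-- `Follow(e)`: the pairs `(x, y)` of marked letters (positions) such that `y` can
immediately follow `x` in some word of the language of the marked expression. -/
def Follow {A : Type} (e : RegEx A) : Set ((A × ℕ) × (A × ℕ)) :=
  {q | ∃ u v : List (A × ℕ), u ++ q.1 :: q.2 :: v ∈ lang (mark e)}

end RegEx

/-- `t_n`: the sum of `|First(α)| + |Follow(α)|` (i.e. the number of transitions of the
Glushkov automaton of `α`) over all `α ∈ REna` of size `n`. -/
noncomputable def Tcount (k n : ℕ) : ℕ :=
  Nat.card {p : RegEx (Fin k) × (Fin k × ℕ) //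
      RegEx.Avoids p.1 ∧ RegEx.size p.1 = n ∧ p.2 ∈ RegEx.First p.1} +
  Nat.card {p : RegEx (Fin k) × ((Fin k × ℕ) × (Fin k × ℕ)) //
      RegEx.Avoids p.1 ∧ RegEx.size p.1 = n ∧ p.2 ∈ RegEx.Follow p.1}

namespace PowerSeries

/-- The weight `(n+1)^(-3/2)`. -/
noncomputable def decayWt (n : ℕ) : ℝ := ((n : ℝ) + 1) ^ (-(3 / 2) : ℝ)

lemma decayWt_pos (n : ℕ) : 0 < decayWt n := by
  unfold decayWt; positivity

lemma summable_decayWt : Summable decayWt := by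
  have h : Summable fun n : ℕ => ((n : ℝ)) ^ (-(3 / 2) : ℝ) :=
    Real.summable_nat_rpow.2 (by norm_num)
  have := (summable_nat_add_iff 1).2 h
  refine this.congr fun n => ?_
  simp [decayWt]

lemma decayWt_le_of_mul_le {c : ℝ} (hc : 0 < c) {m n : ℕ}
    (h : c * ((n : ℝ) + 1) ≤ (m : ℝ) + 1) :
    decayWt m ≤ c ^ (-(3 / 2) : ℝ) * decayWt n := by
  unfold decayWt
  rw [← Real.mul_rpow hc.le (by positivity)]
  exact Real.rpow_le_rpow_of_nonpos (by positivity) h (by norm_num)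

lemma decayWt_mul_le (i j : ℕ) :
    decayWt i * decayWt j ≤
      ((1 / 2 : ℝ) ^ (-(3 / 2) : ℝ) * decayWt (i + j)) * (decayWt i + decayWt j) := by
  have hi := decayWt_pos i
  have hj := decayWt_pos j
  have hc : 0 < (1 / 2 : ℝ) ^ (-(3 / 2) : ℝ) * decayWt (i + j) :=
    mul_pos (by positivity) (decayWt_pos _)
  rcases le_total i j with h | h
  · have h1 : decayWt j ≤ (1 / 2 : ℝ) ^ (-(3 / 2) : ℝ) * decayWt (i + j) := by
      apply decayWt_le_of_mul_le (by norm_num)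
      have : (i : ℝ) ≤ j := by exact_mod_cast h
      push_cast; linarith
    nlinarith
  · have h1 : decayWt i ≤ (1 / 2 : ℝ) ^ (-(3 / 2) : ℝ) * decayWt (i + j) := by
      apply decayWt_le_of_mul_le (by norm_num)
      have : (j : ℝ) ≤ i := by exact_mod_cast h
      push_cast; linarith
    nlinarith

/-- The coefficients of `h` are `O(n^(-3/2))` and sum to `v`. -/
def HasDecaySum (h : ℝ⟦X⟧) (v : ℝ) : Prop :=
  (∃ K, ∀ n, |coeff n h| ≤ K * decayWt n) ∧ HasSum (fun n => coeff n h) v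

lemma HasDecaySum.unique {h : ℝ⟦X⟧} {a b : ℝ} (ha : HasDecaySum h a) (hb : HasDecaySum h b) : a = b :=
  ha.2.unique hb.2

lemma hasDecaySum_of_le {h : ℝ⟦X⟧} {K : ℝ} (hK : ∀ n, |coeff n h| ≤ K * decayWt n) :
    HasDecaySum h (∑' n, coeff n h) :=
  ⟨⟨K, hK⟩, (Summable.of_norm_bounded (summable_decayWt.mul_left K) hK).hasSum⟩

lemma HasDecaySum.add {f g : ℝ⟦X⟧} {a b : ℝ} (hf : HasDecaySum f a) (hg : HasDecaySum g b) :
    HasDecaySum (f + g) (a + b) := by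
  obtain ⟨⟨K, hK⟩, hf⟩ := hf
  obtain ⟨⟨L, hL⟩, hg⟩ := hg
  refine ⟨⟨K + L, fun n => ?_⟩, by simpa using hf.add hg⟩
  rw [map_add, add_mul]
  exact (abs_add_le _ _).trans (add_le_add (hK n) (hL n))

lemma HasDecaySum.mul {f g : ℝ⟦X⟧} {a b : ℝ} (hf : HasDecaySum f a) (hg : HasDecaySum g b) :
    HasDecaySum (f * g) (a * b) := by
  obtain ⟨⟨K, hK⟩, hf⟩ := hf
  obtain ⟨⟨L, hL⟩, hg⟩ := hg
  have hK0 : 0 ≤ K := by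
    by_contra! h
    have := (abs_nonneg _).trans (hK 0)
    nlinarith [decayWt_pos 0]
  have hL0 : 0 ≤ L := by
    by_contra! h
    have := (abs_nonneg _).trans (hL 0)
    nlinarith [decayWt_pos 0]
  have hfs : Summable fun n => ‖coeff n f‖ :=
    Summable.of_nonneg_of_le (fun n => norm_nonneg _) hK (summable_decayWt.mul_left K)
  have hgs : Summable fun n => ‖coeff n g‖ :=
    Summable.of_nonneg_of_le (fun n => norm_nonneg _) hL (summable_decayWt.mul_left L)
  have key : ∀ n, |coeff n (f * g)| ≤
      (K * L * ((1 / 2 : ℝ) ^ (-(3 / 2) : ℝ) * (2 * ∑' n, decayWt n))) * decayWt n := by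
    intro n
    rw [coeff_mul]
    refine (Finset.abs_sum_le_sum_abs _ _).trans ?_
    have h1 : ∀ p ∈ Finset.HasAntidiagonal.antidiagonal n, |coeff p.1 f * coeff p.2 g| ≤
        K * L * ((1 / 2 : ℝ) ^ (-(3 / 2) : ℝ) * decayWt n) * (decayWt p.1 + decayWt p.2) := by
      intro p hp
      rw [abs_mul]
      have h2 := decayWt_mul_le p.1 p.2
      rw [Finset.HasAntidiagonal.mem_antidiagonal.1 hp] at h2
      calc _ ≤ (K * decayWt p.1) * (L * decayWt p.2) :=
            mul_le_mul (hK _) (hL _) (abs_nonneg _) (mul_nonneg hK0 (decayWt_pos _).le)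
        _ = K * L * (decayWt p.1 * decayWt p.2) := by ring
        _ ≤ K * L * (((1 / 2 : ℝ) ^ (-(3 / 2) : ℝ) * decayWt n) * (decayWt p.1 + decayWt p.2)) :=
            mul_le_mul_of_nonneg_left h2 (mul_nonneg hK0 hL0)
        _ = _ := by ring
    refine (Finset.sum_le_sum h1).trans ?_
    rw [← Finset.mul_sum, Finset.sum_add_distrib]
    have hs : ∑ p ∈ Finset.HasAntidiagonal.antidiagonal n, decayWt p.1 ≤ ∑' n, decayWt n := by
      rw [Finset.Nat.sum_antidiagonal_eq_sum_range_succ (fun i _ => decayWt i)]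
      exact summable_decayWt.sum_le_tsum _ (fun i _ => (decayWt_pos i).le)
    have hs' : ∑ p ∈ Finset.HasAntidiagonal.antidiagonal n, decayWt p.2 ≤ ∑' n, decayWt n := by
      rw [← Finset.Nat.sum_antidiagonal_swap]
      exact hs
    have hc : 0 ≤ K * L * ((1 / 2 : ℝ) ^ (-(3 / 2) : ℝ) * decayWt n) :=
      mul_nonneg (mul_nonneg hK0 hL0) (mul_nonneg (by positivity) (decayWt_pos _).le)
    calc _ ≤ K * L * ((1 / 2 : ℝ) ^ (-(3 / 2) : ℝ) * decayWt n) * (2 * ∑' n, decayWt n) :=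
          mul_le_mul_of_nonneg_left (by linarith) hc
      _ = _ := by ring
  refine ⟨⟨_, key⟩, ?_⟩
  have hsum := (hasDecaySum_of_le key).2
  have : ∑' n, coeff n (f * g) = a * b := by
    rw [← hf.tsum_eq, ← hg.tsum_eq, tsum_mul_tsum_eq_tsum_sum_antidiagonal_of_summable_norm hfs hgs]
    exact tsum_congr fun n => coeff_mul _ _ _
  rwa [this] at hsum

lemma hasDecaySum_of_eventually_zero {f : ℝ⟦X⟧} (N : ℕ) (h : ∀ n, N ≤ n → coeff n f = 0) :
    HasDecaySum f (∑ n ∈ Finset.range N, coeff n f) := by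
  have hs : HasSum (fun n => coeff n f) (∑ n ∈ Finset.range N, coeff n f) :=
    hasSum_sum_of_ne_finset_zero fun n hn => h n (by simpa using hn)
  refine ⟨⟨∑ n ∈ Finset.range N, |coeff n f| / decayWt n, fun n => ?_⟩, hs⟩
  rcases lt_or_ge n N with hn | hn
  · have := Finset.single_le_sum (f := fun n => |coeff n f| / decayWt n)
      (fun i _ => div_nonneg (abs_nonneg _) (decayWt_pos i).le) (Finset.mem_range.2 hn)
    exact (div_le_iff₀ (decayWt_pos n)).1 this
  · rw [h n hn, abs_zero]
    exact mul_nonneg (Finset.sum_nonneg fun i _ => div_nonneg (abs_nonneg _) (decayWt_pos i).le)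
      (decayWt_pos n).le

lemma hasDecaySum_C (a : ℝ) : HasDecaySum (C a) a := by
  have := hasDecaySum_of_eventually_zero (f := C a) 1 (fun n hn => by
    rw [coeff_C, if_neg (by omega)])
  simpa using this

lemma hasDecaySum_X : HasDecaySum (X : ℝ⟦X⟧) 1 := by
  have := hasDecaySum_of_eventually_zero (f := (X : ℝ⟦X⟧)) 2 (fun n hn => by
    rw [coeff_X, if_neg (by omega)])
  simpa [Finset.sum_range_succ, coeff_X] using this

lemma hasDecaySum_one : HasDecaySum (1 : ℝ⟦X⟧) 1 := by simpa using hasDecaySum_C 1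

lemma HasDecaySum.neg {f : ℝ⟦X⟧} {a : ℝ} (hf : HasDecaySum f a) : HasDecaySum (-f) (-a) := by
  simpa using (hasDecaySum_C (-1)).mul hf

lemma HasDecaySum.sub {f g : ℝ⟦X⟧} {a b : ℝ} (hf : HasDecaySum f a) (hg : HasDecaySum g b) :
    HasDecaySum (f - g) (a - b) := by
  simpa [sub_eq_add_neg] using hf.add hg.neg

lemma HasDecaySum.pow {f : ℝ⟦X⟧} {a : ℝ} (hf : HasDecaySum f a) (n : ℕ) :
    HasDecaySum (f ^ n) (a ^ n) := by
  induction n with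
  | zero => simpa using hasDecaySum_one
  | succ n ih => rw [pow_succ, pow_succ]; exact ih.mul hf

lemma hasDecaySum_ofNat (n : ℕ) [n.AtLeastTwo] :
    HasDecaySum (OfNat.ofNat n : ℝ⟦X⟧) (OfNat.ofNat n : ℝ) := by
  have := hasDecaySum_C (OfNat.ofNat n : ℝ)
  rwa [map_ofNat] at this

lemma HasDecaySum.of_X_mul {f : ℝ⟦X⟧} {a : ℝ} (hf : HasDecaySum (X * f) a) : HasDecaySum f a := by
  obtain ⟨⟨K, hK⟩, hs⟩ := hf
  have hK0 : 0 ≤ K := by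
    by_contra! h
    have := (abs_nonneg _).trans (hK 0)
    nlinarith [decayWt_pos 0]
  refine ⟨⟨K, fun n => ?_⟩, ?_⟩
  · have h1 := hK (n + 1)
    rw [coeff_succ_X_mul] at h1
    refine h1.trans (mul_le_mul_of_nonneg_left ?_ hK0)
    have := decayWt_le_of_mul_le (c := 1) one_pos (m := n + 1) (n := n) (by push_cast; linarith)
    simpa using this
  · have := (hasSum_nat_add_iff' 1).2 hs
    simpa using this

lemma HasDecaySum.of_mul_one_sub {V f g : ℝ⟦X⟧} {v b : ℝ} (hV : HasDecaySum V v)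
    (hV0 : ∀ n, 0 ≤ coeff n V) (hVc : coeff 0 V = 0) (hv : v < 1) (hg : HasDecaySum g b)
    (h : f * (1 - V) = g) : HasDecaySum f (b / (1 - v)) := by
  -- it suffices to treat the inverse of `1 - V`
  set x : ℝ⟦X⟧ := (1 - V)⁻¹ with hx
  have hc : constantCoeff (1 - V) ≠ 0 := by
    rw [← coeff_zero_eq_constantCoeff_apply, map_sub, hVc]; simp
  have hx1 : x * (1 - V) = 1 := PowerSeries.inv_mul_cancel _ hc
  have hfx : f = g * x := by
    rw [← h, mul_assoc, mul_comm (1 - V) x, hx1, mul_one]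
  have hxV : x = 1 + V * x := by linear_combination hx1
  have hrec : ∀ n, coeff n x = (if n = 0 then 1 else 0) +
      ∑ p ∈ Finset.HasAntidiagonal.antidiagonal n, coeff p.1 V * coeff p.2 x := by
    intro n
    conv_lhs => rw [hxV]
    rw [map_add, coeff_one, coeff_mul]
  have hv0 : 0 ≤ v := hV.2.nonneg hV0
  have hx0 : ∀ n, 0 ≤ coeff n x := by
    intro n
    induction n using Nat.strong_induction_on with
    | _ n ih =>
      rw [hrec]
      refine add_nonneg (by split_ifs <;> norm_num) (Finset.sum_nonneg fun p hp => ?_)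
      rcases Nat.eq_zero_or_pos p.1 with h0 | h0
      · rw [h0, hVc, zero_mul]
      · exact mul_nonneg (hV0 _) (ih _ (by have := Finset.HasAntidiagonal.mem_antidiagonal.1 hp; omega))
  have hpart : ∀ N, ∑ n ∈ Finset.range N, coeff n x ≤ 1 / (1 - v) := by
    intro N
    have h1 : ∑ n ∈ Finset.range N, ∑ p ∈ Finset.HasAntidiagonal.antidiagonal n, coeff p.1 V * coeff p.2 x ≤
        v * ∑ n ∈ Finset.range N, coeff n x := by
      calc _ = ∑ q ∈ (Finset.range N).sigma (fun n => Finset.HasAntidiagonal.antidiagonal n),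
            coeff q.2.1 V * coeff q.2.2 x := by rw [Finset.sum_sigma]
        _ ≤ ∑ p ∈ Finset.range N ×ˢ Finset.range N, coeff p.1 V * coeff p.2 x := by
            rw [← Finset.sum_image (g := fun q : (_ : ℕ) × ℕ × ℕ => q.2)
              (f := fun p => coeff p.1 V * coeff p.2 x)]
            · refine Finset.sum_le_sum_of_subset_of_nonneg ?_
                fun p _ _ => mul_nonneg (hV0 _) (hx0 _)
              intro p hp
              obtain ⟨⟨n, p'⟩, hq, rfl⟩ := Finset.mem_image.1 hp
              simp only [Finset.mem_sigma, Finset.mem_range,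
                Finset.HasAntidiagonal.mem_antidiagonal] at hq
              simp only [Finset.mem_product, Finset.mem_range]
              omega
            · rintro ⟨n, p⟩ hq ⟨n', p'⟩ hq' hh
              simp only [Finset.coe_sigma, Set.mem_sigma_iff, Finset.mem_coe, Finset.mem_range,
                Finset.HasAntidiagonal.mem_antidiagonal] at hq hq' hh
              subst hh
              obtain rfl : n = n' := by omega
              rfl
        _ = (∑ n ∈ Finset.range N, coeff n V) * ∑ n ∈ Finset.range N, coeff n x := by
            rw [Finset.sum_product, Finset.sum_mul_sum]
        _ ≤ _ := mul_le_mul_of_nonneg_right (sum_le_hasSum _ (fun i _ => hV0 i) hV.2)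
            (Finset.sum_nonneg fun i _ => hx0 i)
    have h2 : ∑ n ∈ Finset.range N, coeff n x ≤ 1 + v * ∑ n ∈ Finset.range N, coeff n x := by
      conv_lhs => rw [Finset.sum_congr rfl (fun n _ => hrec n), Finset.sum_add_distrib]
      refine add_le_add ?_ h1
      rw [Finset.sum_ite_eq']
      split_ifs <;> norm_num
    rw [le_div_iff₀ (by linarith)]
    linarith
  obtain ⟨⟨K, hK⟩, hVs⟩ := hV
  obtain ⟨δ, hδ0, hδ1, hθ⟩ : ∃ δ : ℝ, 0 < δ ∧ δ < 1 ∧ v * (1 - δ) ^ (-(3 / 2) : ℝ) < 1 := by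
    have hcont : ContinuousAt (fun δ : ℝ => v * (1 - δ) ^ (-(3 / 2) : ℝ)) 0 := by
      refine continuousAt_const.mul (ContinuousAt.rpow_const (by fun_prop) (Or.inl (by norm_num)))
    have hev : ∀ᶠ δ in nhds (0 : ℝ), v * (1 - δ) ^ (-(3 / 2) : ℝ) < 1 := by
      apply hcont.eventually_lt continuousAt_const
      simpa using hv
    have hev' : ∀ᶠ δ in nhdsWithin (0 : ℝ) (Set.Ioi 0), v * (1 - δ) ^ (-(3 / 2) : ℝ) < 1 :=
      hev.filter_mono nhdsWithin_le_nhds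
    have hlt : ∀ᶠ δ in nhdsWithin (0 : ℝ) (Set.Ioi 0), δ < 1 :=
      (eventually_lt_nhds one_pos).filter_mono nhdsWithin_le_nhds
    obtain ⟨δ, h1, h2, h3⟩ := (hev'.and (hlt.and self_mem_nhdsWithin)).exists
    exact ⟨δ, h3, h2, h1⟩
  set θ := (1 - δ) ^ (-(3 / 2) : ℝ) with hθdef
  have hθ0 : 0 < θ := Real.rpow_pos_of_pos (by linarith) _
  have hK0 : 0 ≤ K := by
    by_contra! h
    have := (abs_nonneg _).trans (hK 0)
    nlinarith [decayWt_pos 0]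
  set L := K * δ ^ (-(3 / 2) : ℝ) with hL
  have hL0 : 0 ≤ L := mul_nonneg hK0 (Real.rpow_nonneg hδ0.le _)
  set S := 1 / (1 - v) with hS
  have hS0 : 0 ≤ S := by rw [hS]; apply div_nonneg zero_le_one; linarith
  set K' := (1 + L * S) / (1 - v * θ) with hK'
  have hd : 0 < 1 - v * θ := by linarith
  have hK'0 : 0 ≤ K' := div_nonneg (by positivity) hd.le
  have hK'eq : K' * (v * θ) + L * S + 1 = K' := by
    rw [hK']; field_simp; ring
  have hbound : ∀ n, coeff n x ≤ K' * decayWt n := by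
    intro n
    induction n using Nat.strong_induction_on with
    | _ n ih =>
      rw [hrec]
      have hw := decayWt_pos n
      have h1 : ∀ p ∈ Finset.HasAntidiagonal.antidiagonal n, coeff p.1 V * coeff p.2 x ≤
          (K' * θ * coeff p.1 V + L * coeff p.2 x) * decayWt n := by
        intro p hp
        have hpn := Finset.HasAntidiagonal.mem_antidiagonal.1 hp
        have hpn' : (p.1 : ℝ) + p.2 = n := by exact_mod_cast hpn
        rcases le_or_gt (p.1 : ℝ) (δ * ((n : ℝ) + 1)) with hle | hgt
        · rcases Nat.eq_zero_or_pos p.1 with h0 | h0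
          · rw [h0, hVc, zero_mul]
            exact mul_nonneg (by have := mul_nonneg hL0 (hx0 p.2); simpa using this) hw.le
          · have h2 := ih p.2 (by omega)
            have h3 : decayWt p.2 ≤ θ * decayWt n :=
              decayWt_le_of_mul_le (by linarith) (by linarith)
            have h4 : coeff p.2 x ≤ K' * (θ * decayWt n) :=
              h2.trans (mul_le_mul_of_nonneg_left h3 hK'0)
            have h5 := mul_le_mul_of_nonneg_left h4 (hV0 p.1)
            have h6 := mul_nonneg (mul_nonneg hL0 (hx0 p.2)) hw.le
            nlinarith
        · have h3 : decayWt p.1 ≤ δ ^ (-(3 / 2) : ℝ) * decayWt n :=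
            decayWt_le_of_mul_le hδ0 (by linarith)
          have h4 : coeff p.1 V ≤ L * decayWt n := by
            refine (le_abs_self _).trans ((hK p.1).trans ?_)
            rw [hL, mul_assoc]
            exact mul_le_mul_of_nonneg_left h3 hK0
          have h5 := mul_le_mul_of_nonneg_right h4 (hx0 p.2)
          have h6 := mul_nonneg (mul_nonneg (mul_nonneg hK'0 hθ0.le) (hV0 p.1)) hw.le
          nlinarith
      have h2 : ∑ p ∈ Finset.HasAntidiagonal.antidiagonal n, coeff p.1 V * coeff p.2 x ≤
          (K' * θ * v + L * S) * decayWt n := by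
        refine (Finset.sum_le_sum h1).trans ?_
        rw [← Finset.sum_mul, Finset.sum_add_distrib, ← Finset.mul_sum, ← Finset.mul_sum]
        have h3 : ∑ p ∈ Finset.HasAntidiagonal.antidiagonal n, coeff p.1 V ≤ v := by
          rw [Finset.Nat.sum_antidiagonal_eq_sum_range_succ (fun i _ => coeff i V)]
          exact sum_le_hasSum _ (fun i _ => hV0 i) hVs
        have h4 : ∑ p ∈ Finset.HasAntidiagonal.antidiagonal n, coeff p.2 x ≤ S := by
          rw [← Finset.Nat.sum_antidiagonal_swap]
          simp only [Prod.snd_swap]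
          rw [Finset.Nat.sum_antidiagonal_eq_sum_range_succ (fun i _ => coeff i x)]
          exact hpart _
        refine mul_le_mul_of_nonneg_right (add_le_add ?_ ?_) hw.le
        · exact mul_le_mul_of_nonneg_left h3 (mul_nonneg hK'0 hθ0.le)
        · exact mul_le_mul_of_nonneg_left h4 hL0
      have h3 : (if n = 0 then (1 : ℝ) else 0) ≤ 1 * decayWt n := by
        split_ifs with h0
        · subst h0; simp [decayWt]
        · simpa using hw.le
      calc _ ≤ 1 * decayWt n + (K' * θ * v + L * S) * decayWt n := add_le_add h3 h2
        _ = (K' * (v * θ) + L * S + 1) * decayWt n := by ring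
        _ = _ := by rw [hK'eq]
  have hxe := hasDecaySum_of_le (h := x) (K := K') (fun n => by
    rw [abs_of_nonneg (hx0 n)]; exact hbound n)
  have hVe : HasDecaySum V v := ⟨⟨K, hK⟩, hVs⟩
  have h1 := (hxe.mul (hasDecaySum_one.sub hVe)).unique (hx1 ▸ hasDecaySum_one)
  have h2 : ∑' n, coeff n x = 1 / (1 - v) := by
    rw [eq_div_iff (by linarith)]; exact h1
  rw [h2] at hxe
  rw [hfx, div_eq_mul_one_div]
  exact hg.mul hxe

/-- The coefficients `binom (2 * n, n) / 4 ^ n` of `(1 - X)^(-1/2)`. -/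
noncomputable def invSqrtCoeff (n : ℕ) : ℝ := (n.centralBinom : ℝ) / 4 ^ n

lemma invSqrtCoeff_zero : invSqrtCoeff 0 = 1 := by simp [invSqrtCoeff]

lemma invSqrtCoeff_pos (n : ℕ) : 0 < invSqrtCoeff n := by
  have : 0 < (n.centralBinom : ℝ) := by exact_mod_cast Nat.centralBinom_pos n
  unfold invSqrtCoeff; positivity

lemma invSqrtCoeff_succ (n : ℕ) :
    (2 * (n : ℝ) + 2) * invSqrtCoeff (n + 1) = (2 * n + 1) * invSqrtCoeff n := by
  have h : ((n : ℝ) + 1) * (n + 1).centralBinom = 2 * (2 * n + 1) * n.centralBinom := by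
    exact_mod_cast Nat.succ_mul_centralBinom_succ n
  unfold invSqrtCoeff
  rw [pow_succ]
  field_simp
  linarith

lemma sum_invSqrtCoeff (n : ℕ) :
    ∑ j ∈ Finset.range (n + 1), invSqrtCoeff j = (2 * n + 1) * invSqrtCoeff n := by
  induction n with
  | zero => simp
  | succ n ih =>
    rw [Finset.sum_range_succ, ih, ← invSqrtCoeff_succ]
    push_cast; ring

lemma sq_invSqrtCoeff_mul_le (n : ℕ) : invSqrtCoeff n ^ 2 * (2 * n + 1) ≤ 1 := by
  induction n with
  | zero => simp [invSqrtCoeff_zero]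
  | succ n ih =>
    have h : invSqrtCoeff (n + 1) = (2 * n + 1) * invSqrtCoeff n / (2 * (n : ℝ) + 2) := by
      rw [eq_div_iff (by positivity), mul_comm]; exact invSqrtCoeff_succ n
    have h2 : invSqrtCoeff (n + 1) ^ 2 * (2 * ((n + 1 : ℕ) : ℝ) + 1) =
        invSqrtCoeff n ^ 2 * (2 * n + 1) * ((2 * n + 1) * (2 * n + 3) / (2 * n + 2) ^ 2) := by
      rw [h]; push_cast; field_simp; ring
    rw [h2]
    have h3 : ((2 * n + 1) * (2 * n + 3) / (2 * n + 2) ^ 2 : ℝ) ≤ 1 := by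
      rw [div_le_one (by positivity)]; nlinarith
    exact mul_le_one₀ ih (by positivity) h3

lemma one_le_sq_invSqrtCoeff_mul (n : ℕ) : 1 ≤ 4 * ((n : ℝ) + 1) * invSqrtCoeff n ^ 2 := by
  have key : ∀ n : ℕ, 1 ≤ 4 * ((n : ℝ) + 1) * invSqrtCoeff (n + 1) ^ 2 := by
    intro n
    induction n with
    | zero =>
      have := invSqrtCoeff_succ 0
      rw [invSqrtCoeff_zero] at this
      norm_num at this ⊢
      nlinarith
    | succ n ih =>
      have h : invSqrtCoeff (n + 1 + 1) =
          (2 * n + 3) * invSqrtCoeff (n + 1) / (2 * (n : ℝ) + 4) := by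
        rw [eq_div_iff (by positivity), mul_comm]
        have := invSqrtCoeff_succ (n + 1)
        push_cast at this
        linarith
      have h2 : 4 * (((n + 1 : ℕ) : ℝ) + 1) * invSqrtCoeff (n + 1 + 1) ^ 2 =
          4 * ((n : ℝ) + 1) * invSqrtCoeff (n + 1) ^ 2 *
            ((n + 2) * (2 * n + 3) ^ 2 / ((n + 1) * (2 * n + 4) ^ 2)) := by
        rw [h]; push_cast; field_simp; ring
      rw [h2]
      refine one_le_mul_of_one_le_of_one_le ih ?_
      rw [le_div_iff₀ (by positivity)]
      nlinarith
  cases n with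
  | zero => simp [invSqrtCoeff_zero]
  | succ n =>
    refine (key n).trans ?_
    push_cast
    nlinarith [sq_nonneg (invSqrtCoeff (n + 1))]

lemma invSqrtCoeff_sub_le {m n : ℕ} (h : 2 * m ≤ n) :
    invSqrtCoeff (n - m) ≤ 2 * invSqrtCoeff n := by
  refine le_of_sq_le_sq ?_ (by linarith [invSqrtCoeff_pos n])
  have h1 := sq_invSqrtCoeff_mul_le (n - m)
  have h2 := one_le_sq_invSqrtCoeff_mul n
  have h3 : (n : ℝ) ≤ 2 * ((n - m : ℕ) : ℝ) := by
    have : n ≤ 2 * (n - m) := by omega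
    exact_mod_cast this
  have h4 : invSqrtCoeff (n - m) ^ 2 * ((n : ℝ) + 1) ≤ 1 :=
    (mul_le_mul_of_nonneg_left (by linarith) (sq_nonneg _)).trans h1
  have h5 : ((n : ℝ) + 1) * invSqrtCoeff (n - m) ^ 2 ≤
      ((n : ℝ) + 1) * (2 * invSqrtCoeff n) ^ 2 := by nlinarith
  exact le_of_mul_le_mul_left h5 (by positivity)

lemma tendsto_invSqrtCoeff_sub_div (m : ℕ) :
    Tendsto (fun n => invSqrtCoeff (n - m) / invSqrtCoeff n) atTop (nhds 1) := by
  have key : Tendsto (fun n => invSqrtCoeff n / invSqrtCoeff (n + m)) atTop (nhds 1) := by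
    induction m with
    | zero =>
      refine tendsto_const_nhds.congr fun n => ?_
      rw [add_zero, div_self (invSqrtCoeff_pos n).ne']
    | succ m ih =>
      have h1 : Tendsto (fun n : ℕ => 1 + 1 / (2 * ((n + m : ℕ) : ℝ) + 1)) atTop (nhds (1 + 0)) := by
        refine tendsto_const_nhds.add (Tendsto.div_atTop tendsto_const_nhds ?_)
        refine tendsto_atTop_add_const_right _ _ (Tendsto.const_mul_atTop two_pos ?_)
        exact tendsto_natCast_atTop_atTop.comp (tendsto_add_atTop_nat m)
      have h2 := ih.mul h1
      rw [add_zero, mul_one] at h2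
      refine h2.congr fun n => ?_
      have h3 := invSqrtCoeff_succ (n + m)
      have p1 := invSqrtCoeff_pos (n + m)
      have p2 := invSqrtCoeff_pos (n + m + 1)
      rw [← add_assoc]
      field_simp
      linear_combination invSqrtCoeff n * h3
  have := key.comp (tendsto_sub_atTop_nat m)
  refine this.congr' ?_
  filter_upwards [eventually_ge_atTop m] with n hn
  simp [Nat.sub_add_cancel hn]

lemma decayWt_mul_succ (n : ℕ) : decayWt n * ((n : ℝ) + 1) = ((n : ℝ) + 1) ^ (-(1 / 2) : ℝ) := by
  unfold decayWt
  rw [← Real.rpow_add_one (by positivity)]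
  norm_num

lemma tendsto_rpow_succ : Tendsto (fun n : ℕ => ((n : ℝ) + 1) ^ (-(1 / 2) : ℝ)) atTop (nhds 0) :=
  (tendsto_rpow_neg_atTop (by norm_num)).comp
    (tendsto_atTop_add_const_right _ _ tendsto_natCast_atTop_atTop)

lemma invSqrtCoeff_le (n : ℕ) : invSqrtCoeff n ≤ ((n : ℝ) + 1) ^ (-(1 / 2) : ℝ) := by
  refine le_of_sq_le_sq ?_ (by positivity)
  rw [← Real.rpow_natCast, ← Real.rpow_natCast, ← Real.rpow_mul (by positivity)]
  norm_num
  rw [Real.rpow_neg_one, ← one_div, le_div_iff₀ (by positivity)]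
  refine le_trans ?_ (sq_invSqrtCoeff_mul_le n)
  exact mul_le_mul_of_nonneg_left (by linarith [(Nat.cast_nonneg n : (0 : ℝ) ≤ n)]) (sq_nonneg _)

lemma le_invSqrtCoeff (n : ℕ) : ((n : ℝ) + 1) ^ (-(1 / 2) : ℝ) ≤ 2 * invSqrtCoeff n := by
  refine le_of_sq_le_sq ?_ (by linarith [invSqrtCoeff_pos n])
  rw [← Real.rpow_natCast, ← Real.rpow_mul (by positivity)]
  norm_num
  rw [Real.rpow_neg_one, ← one_div, div_le_iff₀ (by positivity)]
  nlinarith [one_le_sq_invSqrtCoeff_mul n]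

/-- The power series of `(1 - X)^(-1/2)`. -/
noncomputable def invSqrt : ℝ⟦X⟧ := mk invSqrtCoeff

lemma invSqrt_sq : invSqrt ^ 2 * (1 - X) = 1 := by
  have hD : 2 * (1 - X) * derivative ℝ invSqrt = invSqrt := by
    ext n
    have h : 2 * (1 - X) * derivative ℝ invSqrt =
        C 2 * derivative ℝ invSqrt - C 2 * (X * derivative ℝ invSqrt) := by
      rw [map_ofNat]; ring
    rw [h, map_sub, coeff_C_mul, coeff_C_mul, coeff_derivative]
    cases n with
    | zero =>
      have := invSqrtCoeff_succ 0
      simp [invSqrt] at this ⊢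
      linarith
    | succ n =>
      rw [coeff_succ_X_mul, coeff_derivative]
      have := invSqrtCoeff_succ (n + 1)
      simp only [invSqrt, coeff_mk]
      push_cast at this ⊢
      linarith
  refine derivative.ext ?_ ?_
  · have h1 : derivative ℝ (1 - X : ℝ⟦X⟧) = -1 := by
      rw [map_sub, derivative_X, Derivation.map_one_eq_zero, zero_sub]
    rw [Derivation.leibniz, derivative_pow, h1, Derivation.map_one_eq_zero]
    simp only [smul_eq_mul]
    push_cast
    linear_combination invSqrt * hD
  · have h0 : constantCoeff invSqrt = 1 := by
      rw [← coeff_zero_eq_constantCoeff_apply, invSqrt, coeff_mk, invSqrtCoeff_zero]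
    simp [h0]

lemma hasDecaySum_one_sub_X_mul_invSqrt : ∃ v, HasDecaySum ((1 - X) * invSqrt) v := by
  refine ⟨_, hasDecaySum_of_le (K := (1 / 2 : ℝ) ^ (-(3 / 2) : ℝ)) fun n => ?_⟩
  have hc : (1 : ℝ) ≤ (1 / 2 : ℝ) ^ (-(3 / 2) : ℝ) :=
    Real.one_le_rpow_of_pos_of_le_one_of_nonpos (by norm_num) (by norm_num) (by norm_num)
  rw [sub_mul, one_mul, map_sub]
  cases n with
  | zero => simpa [invSqrt, invSqrtCoeff_zero, decayWt] using hc
  | succ n =>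
    rw [coeff_succ_X_mul]
    simp only [invSqrt, coeff_mk]
    have h1 := invSqrtCoeff_succ n
    have h2 := invSqrtCoeff_le n
    rw [← decayWt_mul_succ] at h2
    have h3 : decayWt n ≤ (1 / 2 : ℝ) ^ (-(3 / 2) : ℝ) * decayWt (n + 1) :=
      decayWt_le_of_mul_le (by norm_num) (by push_cast; linarith)
    have hn : (0 : ℝ) < n + 1 := by positivity
    have h4 := invSqrtCoeff_pos n
    have h5 := decayWt_pos n
    refine le_trans ?_ h3
    have h6 : (n + 1 : ℝ) * |invSqrtCoeff (n + 1) - invSqrtCoeff n| = invSqrtCoeff n / 2 := by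
      rw [abs_of_nonpos (by nlinarith)]
      linarith
    refine le_of_mul_le_mul_left ?_ hn
    rw [h6]
    nlinarith

lemma HasDecaySum.tendsto_coeff_div {h : ℝ⟦X⟧} {v : ℝ} (hh : HasDecaySum h v) :
    Tendsto (fun n => coeff n h / invSqrtCoeff n) atTop (nhds 0) := by
  obtain ⟨⟨K, hK⟩, -⟩ := hh
  have h0 : Tendsto (fun n : ℕ => 2 * K * (1 / ((n : ℝ) + 1))) atTop (nhds (2 * K * 0)) :=
    tendsto_one_div_add_atTop_nhds_zero_nat.const_mul _
  rw [mul_zero] at h0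
  have hK0 : 0 ≤ K := by
    by_contra! h
    have := (abs_nonneg _).trans (hK 0)
    nlinarith [decayWt_pos 0]
  refine squeeze_zero_norm (fun n => ?_) h0
  have h1 := le_invSqrtCoeff n
  rw [← decayWt_mul_succ] at h1
  rw [Real.norm_eq_abs, abs_div, abs_of_pos (invSqrtCoeff_pos n),
    div_le_iff₀ (invSqrtCoeff_pos n)]
  refine (hK n).trans ?_
  have hn : (0 : ℝ) < n + 1 := by positivity
  have h2 : decayWt n ≤ 2 * invSqrtCoeff n / (n + 1) := by rwa [le_div_iff₀ hn]
  calc K * decayWt n ≤ K * (2 * invSqrtCoeff n / (n + 1)) := mul_le_mul_of_nonneg_left h2 hK0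
    _ = _ := by ring

lemma HasDecaySum.tendsto_coeff_mul_invSqrt_div {h : ℝ⟦X⟧} {v : ℝ} (hh : HasDecaySum h v) :
    Tendsto (fun n => coeff n (h * invSqrt) / invSqrtCoeff n) atTop (nhds v) := by
  obtain ⟨⟨K, hK⟩, hs⟩ := hh
  have hK0 : 0 ≤ K := by
    by_contra! h
    have := (abs_nonneg _).trans (hK 0)
    nlinarith [decayWt_pos 0]
  set c := (1 / 2 : ℝ) ^ (-(3 / 2) : ℝ) with hc
  have hc0 : 0 < c := by positivity
  have hsplit : ∀ n, coeff n (h * invSqrt) / invSqrtCoeff n =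
      (∑' m, if 2 * m ≤ n then coeff m h * (invSqrtCoeff (n - m) / invSqrtCoeff n) else 0) +
      (∑ m ∈ Finset.range (n + 1),
        if 2 * m ≤ n then 0 else coeff m h * invSqrtCoeff (n - m)) / invSqrtCoeff n := by
    intro n
    rw [tsum_eq_sum (s := Finset.range (n + 1)), coeff_mul,
      Finset.Nat.sum_antidiagonal_eq_sum_range_succ
        (fun i j => coeff i h * coeff j invSqrt), Finset.sum_div, Finset.sum_div,
      ← Finset.sum_add_distrib]
    · refine Finset.sum_congr rfl fun m _ => ?_
      simp only [invSqrt, coeff_mk]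
      split_ifs
      · ring
      · ring
    · intro m hm
      rw [Finset.mem_range] at hm
      rw [if_neg (by omega)]
  rw [funext hsplit, ← add_zero v]
  refine Tendsto.add ?_ ?_
  · rw [← hs.tsum_eq]
    refine tendsto_tsum_of_dominated_convergence
      (bound := fun m => 2 * (K * decayWt m)) ((summable_decayWt.mul_left K).mul_left 2) ?_ ?_
    · intro m
      have := (tendsto_invSqrtCoeff_sub_div m).const_mul (coeff m h)
      rw [mul_one] at this
      refine this.congr' ?_
      filter_upwards [eventually_ge_atTop (2 * m)] with n hn
      rw [if_pos hn]
    · refine Eventually.of_forall fun n m => ?_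
      split_ifs with hmn
      · rw [norm_mul, Real.norm_eq_abs, Real.norm_eq_abs, mul_comm]
        refine mul_le_mul ?_ (hK m) (abs_nonneg _) two_pos.le
        rw [abs_of_pos (div_pos (invSqrtCoeff_pos _) (invSqrtCoeff_pos _)),
          div_le_iff₀ (invSqrtCoeff_pos _)]
        exact invSqrtCoeff_sub_le hmn
      · rw [norm_zero]
        exact mul_nonneg two_pos.le (mul_nonneg hK0 (decayWt_pos m).le)
  · have h0 : Tendsto (fun n : ℕ => 2 * K * c * ((n : ℝ) + 1) ^ (-(1 / 2) : ℝ)) atTop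
        (nhds (2 * K * c * 0)) := tendsto_rpow_succ.const_mul _
    rw [mul_zero] at h0
    refine squeeze_zero_norm (fun n => ?_) h0
    have hb := invSqrtCoeff_pos n
    rw [Real.norm_eq_abs, abs_div, abs_of_pos hb, div_le_iff₀ hb]
    calc _ ≤ ∑ m ∈ Finset.range (n + 1), K * (c * decayWt n) * invSqrtCoeff (n - m) := by
          refine (Finset.abs_sum_le_sum_abs _ _).trans (Finset.sum_le_sum fun m _ => ?_)
          have hbm := invSqrtCoeff_pos (n - m)
          split_ifs with hmn
          · rw [abs_zero]
            exact mul_nonneg (mul_nonneg hK0 (mul_nonneg hc0.le (decayWt_pos n).le)) hbm.le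
          · rw [abs_mul, abs_of_pos hbm]
            refine mul_le_mul_of_nonneg_right ((hK m).trans ?_) hbm.le
            refine mul_le_mul_of_nonneg_left (decayWt_le_of_mul_le (by norm_num) ?_) hK0
            have : (n : ℝ) + 1 ≤ 2 * m := by
              have : n + 1 ≤ 2 * m := by omega
              exact_mod_cast this
            linarith
      _ = K * (c * decayWt n) * ((2 * n + 1) * invSqrtCoeff n) := by
          rw [← Finset.mul_sum, ← sum_invSqrtCoeff,
            ← Finset.sum_range_reflect (fun j => invSqrtCoeff j) (n + 1)]
          simp
      _ ≤ K * (c * decayWt n) * ((2 * (n + 1)) * invSqrtCoeff n) := by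
          refine mul_le_mul_of_nonneg_left ?_
            (mul_nonneg hK0 (mul_nonneg hc0.le (decayWt_pos n).le))
          exact mul_le_mul_of_nonneg_right (by linarith) hb.le
      _ = _ := by
          rw [← decayWt_mul_succ]; ring

lemma hasDecaySum_of_geometric {f : ℝ⟦X⟧} {K r : ℝ} (hr0 : 0 ≤ r) (hr : r < 1)
    (h : ∀ n, |coeff n f| ≤ K * r ^ n) : ∃ v, HasDecaySum f v := by
  have hK0 : 0 ≤ K := by
    have := (abs_nonneg _).trans (h 0)
    simpa using this
  have h1 : Summable fun n : ℕ => (n : ℝ) ^ 2 * r ^ n :=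
    summable_pow_mul_geometric_of_norm_lt_one 2 (by rwa [Real.norm_eq_abs, abs_of_nonneg hr0])
  have h2 : Summable fun n : ℕ => r ^ n := summable_geometric_of_lt_one hr0 hr
  refine ⟨_, hasDecaySum_of_le
    (K := K * (2 * ∑' n : ℕ, ((n : ℝ) ^ 2 * r ^ n) + 2 * ∑' n : ℕ, r ^ n)) fun n => ?_⟩
  refine (h n).trans ?_
  rw [mul_assoc]
  refine mul_le_mul_of_nonneg_left ?_ hK0
  have a1 := h1.le_tsum n (fun j _ => by positivity)
  have a2 := h2.le_tsum n (fun j _ => by positivity)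
  have hw := decayWt_pos n
  have h3 : 1 ≤ ((n : ℝ) + 1) ^ 2 * decayWt n := by
    unfold decayWt
    rw [← Real.rpow_natCast, ← Real.rpow_add (by positivity)]
    apply Real.one_le_rpow <;> norm_num
  have h4 : ((n : ℝ) + 1) ^ 2 ≤ 2 * n ^ 2 + 2 := by nlinarith [sq_nonneg ((n : ℝ) - 1)]
  calc r ^ n = r ^ n * 1 := (mul_one _).symm
    _ ≤ r ^ n * (((n : ℝ) + 1) ^ 2 * decayWt n) := by gcongr
    _ ≤ r ^ n * ((2 * n ^ 2 + 2) * decayWt n) := by gcongr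
    _ = (2 * ((n : ℝ) ^ 2 * r ^ n) + 2 * r ^ n) * decayWt n := by ring
    _ ≤ _ := by gcongr

lemma hasSum_coeff_mul_pow_mul {P Q : ℂ⟦X⟧} {z v w : ℂ}
    (hP : HasSum (fun n => coeff n P * z ^ n) v) (hQ : HasSum (fun n => coeff n Q * z ^ n) w) :
    HasSum (fun n => coeff n (P * Q) * z ^ n) (v * w) := by
  have hP' := hP.summable.norm
  have hQ' := hQ.summable.norm
  have h1 : ∀ n, ∑ p ∈ Finset.HasAntidiagonal.antidiagonal n,
      (coeff p.1 P * z ^ p.1) * (coeff p.2 Q * z ^ p.2) = coeff n (P * Q) * z ^ n := by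
    intro n
    rw [coeff_mul, Finset.sum_mul]
    refine Finset.sum_congr rfl fun p hp => ?_
    rw [← Finset.HasAntidiagonal.mem_antidiagonal.1 hp, pow_add]
    ring
  have h2 := (summable_norm_sum_mul_antidiagonal_of_summable_norm hP' hQ').of_norm.hasSum
  rw [← tsum_mul_tsum_eq_tsum_sum_antidiagonal_of_summable_norm hP' hQ', hP.tsum_eq,
    hQ.tsum_eq] at h2
  exact h2.congr_fun fun n => (h1 n).symm

lemma hasSum_coeff_polynomial (q : Polynomial ℂ) (z : ℂ) :
    HasSum (fun n => coeff n (q : ℂ⟦X⟧) * z ^ n) (q.eval z) := by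
  rw [Polynomial.eval_eq_sum_range]
  have hs : HasSum (fun n => coeff n (q : ℂ⟦X⟧) * z ^ n)
      (∑ n ∈ Finset.range (q.natDegree + 1), coeff n (q : ℂ⟦X⟧) * z ^ n) :=
    hasSum_sum_of_ne_finset_zero fun n hn => by
      rw [Polynomial.coeff_coe, Polynomial.coeff_eq_zero_of_natDegree_lt, zero_mul]
      have := Finset.mem_range.not.1 hn
      omega
  simpa using hs

lemma eq_zero_of_eventually_hasSum_zero {G : ℂ⟦X⟧}
    (h : ∀ᶠ z in nhds (0 : ℂ), HasSum (fun n => coeff n G * z ^ n) 0) : G = 0 := by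
  have h1 : HasFPowerSeriesAt (0 : ℂ → ℂ)
      (FormalMultilinearSeries.ofScalars ℂ fun n => coeff n G) 0 := by
    rw [hasFPowerSeriesAt_iff]
    filter_upwards [h] with z hz
    simpa [FormalMultilinearSeries.coeff_ofScalars, mul_comm] using hz
  ext n
  have h2 := congrArg (fun p => p.coeff n) h1.eq_zero
  simp only [FormalMultilinearSeries.coeff_ofScalars] at h2
  simpa [FormalMultilinearSeries.coeff] using h2

lemma exists_hasDecaySum_of_sq_mul_eq_one {q : Polynomial ℝ}
    (hq : ∀ z : ℂ, ‖z‖ ≤ 1 → 0 < ((q.map Complex.ofRealHom).eval z).re) {A : ℝ⟦X⟧}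
    (hA : A ^ 2 * (q : ℝ⟦X⟧) = 1) : ∃ v, HasDecaySum A v := by
  set Q : Polynomial ℂ := q.map Complex.ofRealHom with hQ
  have hcont : Continuous fun z => (Q.eval z).re :=
    Complex.continuous_re.comp Q.continuous
  obtain ⟨δ, hδ, hsub⟩ := (isCompact_closedBall (0 : ℂ) 1).exists_cthickening_subset_open
    (isOpen_lt continuous_const hcont) (fun z hz => hq z (by simpa using hz))
  rw [cthickening_closedBall hδ.le zero_le_one] at hsub
  set f : ℂ → ℂ := fun z => (Q.eval z) ^ (-(1 / 2) : ℂ) with hf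
  set R : NNReal := ⟨δ + 1, by positivity⟩ with hR
  have hRpos : 0 < R := by rw [← NNReal.coe_pos]; change 0 < δ + 1; linarith
  have hd : DifferentiableOn ℂ f (Metric.closedBall 0 R) := by
    intro z hz
    have h1 : Q.eval z ∈ Complex.slitPlane := Or.inl (hsub hz)
    exact (Q.differentiable.differentiableAt.cpow_const h1).differentiableWithinAt
  have hps := hd.hasFPowerSeriesOnBall hRpos
  set p := cauchyPowerSeries f 0 R with hp
  set F : ℂ⟦X⟧ := mk fun n => p.coeff n with hF
  have hFq : F ^ 2 * (Q : ℂ⟦X⟧) = 1 := by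
    rw [← sub_eq_zero]
    apply eq_zero_of_eventually_hasSum_zero
    have h1 := hasFPowerSeriesAt_iff.1 hps.hasFPowerSeriesAt
    filter_upwards [h1, Metric.closedBall_mem_nhds (0 : ℂ) (NNReal.coe_pos.2 hRpos)] with z hz hzR
    rw [zero_add] at hz
    have h2 : HasSum (fun n => coeff n F * z ^ n) (f z) := by
      simpa [hF, mul_comm] using hz
    have h3 := hasSum_coeff_mul_pow_mul (hasSum_coeff_mul_pow_mul h2 h2)
      (hasSum_coeff_polynomial Q z)
    have h4 := hasSum_coeff_polynomial 1 z
    have h5 := h3.sub h4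
    have h6 : Q.eval z ≠ 0 := fun h => by
      have := hsub hzR
      simp [h] at this
    have h7 : f z * f z * Q.eval z = 1 := by
      simp only [hf]
      rw [← Complex.cpow_add _ _ h6, show (-(1 / 2) : ℂ) + -(1 / 2) = -1 by norm_num,
        Complex.cpow_neg_one, inv_mul_cancel₀ h6]
    rw [h7, Polynomial.eval_one, sub_self] at h5
    refine h5.congr_fun fun n => ?_
    rw [pow_two, map_sub, Polynomial.coe_one, sub_mul]
  have hAF : ∀ n, |coeff n A| = ‖p n‖ := by
    have hA' : (A.map Complex.ofRealHom) ^ 2 * (Q : ℂ⟦X⟧) = 1 := by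
      have := congrArg (PowerSeries.map Complex.ofRealHom) hA
      rwa [map_mul, map_pow, map_one, ← Polynomial.polynomial_map_coe] at this
    have hQ0 : (Q : ℂ⟦X⟧) ≠ 0 := fun h => by rw [h, mul_zero] at hFq; exact zero_ne_one hFq
    have hsq : (A.map Complex.ofRealHom) ^ 2 = F ^ 2 := mul_right_cancel₀ hQ0 (hA'.trans hFq.symm)
    intro n
    have hn : ‖coeff n (A.map Complex.ofRealHom)‖ = ‖coeff n F‖ := by
      rcases sq_eq_sq_iff_eq_or_eq_neg.1 hsq with h | h <;> simp [h]
    rw [FormalMultilinearSeries.norm_apply_eq_norm_coef]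
    simpa [hF, coeff_map] using hn
  set r : NNReal := ⟨δ / 2 + 1, by positivity⟩ with hr
  have hrR : (r : ENNReal) < p.radius := by
    refine lt_of_lt_of_le ?_ hps.r_le
    rw [ENNReal.coe_lt_coe, ← NNReal.coe_lt_coe]
    change δ / 2 + 1 < δ + 1
    linarith
  obtain ⟨K, -, hK⟩ := p.norm_mul_pow_le_of_lt_radius hrR
  refine hasDecaySum_of_geometric (K := K) (r := (δ / 2 + 1)⁻¹) (by positivity)
    (inv_lt_one_of_one_lt₀ (by linarith)) fun n => ?_
  rw [hAF, inv_pow, ← div_eq_mul_inv, le_div_iff₀ (by positivity)]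
  exact hK n

lemma hasDecaySum_polynomial (q : Polynomial ℝ) : ∃ v, HasDecaySum (q : ℝ⟦X⟧) v :=
  ⟨_, (hasDecaySum_of_eventually_zero (q.natDegree + 1) fun n hn => by
    rw [Polynomial.coeff_coe, Polynomial.coeff_eq_zero_of_natDegree_lt (by omega)])⟩

lemma exists_inv_of_sq_eq {q : Polynomial ℝ}
    (hq : ∀ z : ℂ, ‖z‖ ≤ 1 → 0 < ((q.map Complex.ofRealHom).eval z).re) {w : ℝ⟦X⟧}
    (hw : w ^ 2 = (1 - X) * (q : ℝ⟦X⟧)) :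
    HasDecaySum w 0 ∧ ∃ (A : ℝ⟦X⟧) (v : ℝ), HasDecaySum A v ∧ v ≠ 0 ∧
      w * (A * invSqrt) = 1 := by
  have hq0 : constantCoeff w ≠ 0 := by
    intro h
    have h1 := congrArg constantCoeff hw
    have h2 := hq 0 (by simp)
    rw [← Polynomial.coeff_zero_eq_eval_zero, Polynomial.coeff_map] at h2
    rw [map_pow, h, map_mul] at h1
    simp only [ne_eq, OfNat.ofNat_ne_zero, not_false_eq_true, zero_pow, map_sub, map_one,
      constantCoeff_X, sub_zero, one_mul, Polynomial.constantCoeff_coe] at h1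
    simp [← h1] at h2
  set U := w⁻¹ with hU
  have hwU : w * U = 1 := PowerSeries.mul_inv_cancel w hq0
  have hs := invSqrt_sq
  set A := (1 - X) * invSqrt * U with hA
  have hAq : A ^ 2 * (q : ℝ⟦X⟧) = 1 := by
    rw [hA]
    linear_combination ((1 - X) * U ^ 2 * q) * hs - U ^ 2 * hw + (w * U + 1) * hwU
  obtain ⟨v, hv⟩ := exists_hasDecaySum_of_sq_mul_eq_one hq hAq
  obtain ⟨b, hb⟩ := hasDecaySum_one_sub_X_mul_invSqrt
  obtain ⟨c, hc⟩ := hasDecaySum_polynomial q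
  have h1 : w = (q : ℝ⟦X⟧) * ((1 - X) * invSqrt) * A := by
    rw [hA]
    linear_combination (-(q : ℝ⟦X⟧) * (1 - X) * U) * hs + U * hw - w * hwU
  have h2 := (hc.mul hb).mul hv
  rw [← h1] at h2
  have h3 : HasDecaySum (w ^ 2) 0 := by
    have := (hasDecaySum_one.sub hasDecaySum_X).mul hc
    rw [sub_self, zero_mul, ← hw] at this
    exact this
  have h4 : c * b * v = 0 := by simpa using (h2.pow 2).unique h3
  rw [h4] at h2
  refine ⟨h2, A, v, hv, ?_, ?_⟩
  · rintro rfl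
    have h5 := (hv.pow 2).mul hc
    rw [hAq] at h5
    simpa using h5.unique hasDecaySum_one
  · rw [hA]
    linear_combination hwU + w * U * hs

end PowerSeries

namespace RegEx

variable {A : Type}

/-- Whether the empty word belongs to the language. -/
def nullable : RegEx A → Bool
  | eps => true
  | char _ => false
  | plus l r => nullable l || nullable r
  | cat l r => nullable l && nullable r
  | star _ => true

/-- The letters occurring in an expression. -/
def syms [DecidableEq A] : RegEx A → Finset A
  | eps => ∅
  | char a => {a}
  | plus l r => syms l ∪ syms r
  | cat l r => syms l ∪ syms r
  | star e => syms e

/-- The letters that can begin a word of the language. -/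
def firsts [DecidableEq A] : RegEx A → Finset A
  | eps => ∅
  | char a => {a}
  | plus l r => firsts l ∪ firsts r
  | cat l r => firsts l ∪ if nullable l then firsts r else ∅
  | star e => firsts e

/-- The letters that can end a word of the language. -/
def lasts [DecidableEq A] : RegEx A → Finset A
  | eps => ∅
  | char a => {a}
  | plus l r => lasts l ∪ lasts r
  | cat l r => lasts r ∪ if nullable r then lasts l else ∅
  | star e => lasts e

/-- The pairs of letters that can be consecutive in a word of the language. -/
def follows [DecidableEq A] : RegEx A → Finset (A × A)
  | eps => ∅
  | char _ => ∅
  | plus l r => follows l ∪ follows r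
  | cat l r => follows l ∪ follows r ∪ lasts l ×ˢ firsts r
  | star e => follows e ∪ lasts e ×ˢ firsts e

lemma lang_nonempty (e : RegEx A) : ∃ w, w ∈ lang e := by
  induction e with
  | eps => exact ⟨[], Language.nil_mem_one⟩
  | char a => exact ⟨[a], Set.mem_singleton _⟩
  | plus l r hl hr => exact hl.imp fun w hw => Or.inl hw
  | cat l r hl hr =>
    obtain ⟨u, hu⟩ := hl
    obtain ⟨v, hv⟩ := hr
    exact ⟨u ++ v, Language.append_mem_mul hu hv⟩
  | star e he => exact ⟨[], Language.nil_mem_kstar _⟩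

lemma nullable_iff (e : RegEx A) : nullable e = true ↔ [] ∈ lang e := by
  induction e with
  | eps => simp [nullable, lang]
  | char a =>
    simp only [nullable, lang, Bool.false_eq_true, false_iff]
    exact fun h => by simpa using (Set.mem_singleton_iff.1 h)
  | plus l r hl hr => simp [nullable, lang, hl, hr, Language.mem_add]
  | cat l r hl hr => simp [nullable, lang, hl, hr, Language.mem_mul]
  | star e he => simp [nullable, lang, Language.nil_mem_kstar]

lemma mem_char_lang {a : A} {w : List A} : w ∈ lang (char a) ↔ w = [a] := Iff.rfl

lemma mem_firsts_iff [DecidableEq A] (e : RegEx A) (x : A) :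
    x ∈ firsts e ↔ ∃ w, x :: w ∈ lang e := by
  induction e with
  | eps => simp [firsts, lang, Language.mem_one]
  | char a => simp [firsts, mem_char_lang]
  | plus l r hl hr => simp [firsts, lang, hl, hr, Language.mem_add, exists_or]
  | cat l r hl hr =>
    simp only [firsts, lang, Finset.mem_union, hl, Language.mem_mul]
    constructor
    · rintro (⟨w, hw⟩ | h)
      · obtain ⟨v, hv⟩ := lang_nonempty r
        exact ⟨w ++ v, _, hw, _, hv, rfl⟩
      · split_ifs at h with hn
        · obtain ⟨w, hw⟩ := hr.1 h
          exact ⟨w, [], (nullable_iff l).1 hn, _, hw, rfl⟩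
        · simp at h
    · rintro ⟨w, u, hu, v, hv, huv⟩
      cases u with
      | nil =>
        right
        rw [if_pos ((nullable_iff l).2 hu)]
        exact hr.2 ⟨w, by simpa [← huv] using hv⟩
      | cons y u =>
        obtain ⟨rfl, rfl⟩ := List.cons.inj huv
        exact Or.inl ⟨u, hu⟩
  | star e he =>
    simp only [firsts, lang, he]
    constructor
    · rintro ⟨w, hw⟩
      exact ⟨w, Language.mem_kstar.2 ⟨[x :: w], by simp, by simpa using hw⟩⟩
    · rintro ⟨w, hw⟩
      obtain ⟨L, hL, hL'⟩ := Language.mem_kstar_iff_exists_nonempty.1 hw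
      cases L with
      | nil => simp at hL
      | cons y L =>
        have hy := hL' y (by simp)
        cases y with
        | nil => simp at hy
        | cons z y =>
          simp only [List.flatten_cons, List.cons_append, List.cons.injEq] at hL
          obtain ⟨rfl, -⟩ := hL
          exact ⟨y, hy.1⟩

/-- The expression read from right to left. -/
def rev : RegEx A → RegEx A
  | eps => eps
  | char a => char a
  | plus l r => plus (rev l) (rev r)
  | cat l r => cat (rev r) (rev l)
  | star e => star (rev e)

lemma lang_rev (e : RegEx A) : lang (rev e) = (lang e).reverse := by
  induction e with
  | eps => simp [rev, lang]
  | char a =>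
    ext w
    simp only [rev, Language.mem_reverse, mem_char_lang]
    rw [List.reverse_eq_iff]
    rfl
  | plus l r hl hr => simp [rev, lang, hl, hr]
  | cat l r hl hr => simp [rev, lang, hl, hr]
  | star e he => simp [rev, lang, he]

lemma nullable_rev (e : RegEx A) : nullable (rev e) = nullable e := by
  induction e with
  | eps | char => rfl
  | plus l r hl hr => simp [rev, nullable, hl, hr]
  | cat l r hl hr => simp [rev, nullable, hl, hr, Bool.and_comm]
  | star e he => rfl

lemma firsts_rev [DecidableEq A] (e : RegEx A) : firsts (rev e) = lasts e := by
  induction e with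
  | eps | char => rfl
  | plus l r hl hr => simp [rev, firsts, lasts, hl, hr]
  | cat l r hl hr => simp [rev, firsts, lasts, hl, hr, nullable_rev]
  | star e he => simp [rev, firsts, lasts, he]

lemma mem_lasts_iff [DecidableEq A] (e : RegEx A) (x : A) :
    x ∈ lasts e ↔ ∃ w, w ++ [x] ∈ lang e := by
  rw [← firsts_rev, mem_firsts_iff]
  simp only [lang_rev, Language.mem_reverse, List.reverse_cons]
  exact ⟨fun ⟨w, hw⟩ => ⟨_, hw⟩, fun ⟨w, hw⟩ => ⟨w.reverse, by simpa using hw⟩⟩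

lemma append_eq_append_cons_cons {p q u v : List A} {x y : A} (h : p ++ q = u ++ x :: y :: v) :
    (∃ v', p = u ++ x :: y :: v') ∨ (p = u ++ [x] ∧ q = y :: v) ∨
      ∃ u', q = u' ++ x :: y :: v := by
  rcases List.append_eq_append_iff.1 h with ⟨as, h1, h2⟩ | ⟨bs, h1, h2⟩
  · exact Or.inr (Or.inr ⟨as, h2⟩)
  · cases bs with
    | nil => exact Or.inr (Or.inr ⟨[], by simpa using h2.symm⟩)
    | cons z bs =>
      obtain ⟨rfl, h3⟩ := List.cons.inj h2
      cases bs with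
      | nil => exact Or.inr (Or.inl ⟨h1, by simpa using h3.symm⟩)
      | cons t bs =>
        obtain ⟨rfl, h4⟩ := List.cons.inj h3
        exact Or.inl ⟨bs, h1⟩

lemma mem_follows_iff [DecidableEq A] (e : RegEx A) (x y : A) :
    (x, y) ∈ follows e ↔ ∃ u v, u ++ x :: y :: v ∈ lang e := by
  induction e with
  | eps => simp [follows, lang, Language.mem_one]
  | char a =>
    simp only [follows, mem_char_lang, Finset.notMem_empty, false_iff]
    rintro ⟨u, v, h⟩
    have := congrArg List.length h
    simp at this
    omega
  | plus l r hl hr => simp [follows, lang, hl, hr, Language.mem_add, exists_or]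
  | cat l r hl hr =>
    simp only [follows, lang, Finset.mem_union, hl, hr, Language.mem_mul, Finset.mem_product,
      mem_firsts_iff, mem_lasts_iff]
    constructor
    · rintro ((⟨u, v, h⟩ | ⟨u, v, h⟩) | ⟨⟨u, hu⟩, ⟨v, hv⟩⟩)
      · obtain ⟨w, hw⟩ := lang_nonempty r
        exact ⟨u, v ++ w, _, h, _, hw, by simp⟩
      · obtain ⟨w, hw⟩ := lang_nonempty l
        exact ⟨w ++ u, v, _, hw, _, h, by simp⟩
      · exact ⟨u, v, _, hu, _, hv, by simp⟩
    · rintro ⟨u, v, p, hp, q, hq, h⟩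
      rcases append_eq_append_cons_cons h with ⟨v', rfl⟩ | ⟨rfl, rfl⟩ | ⟨u', rfl⟩
      · exact Or.inl (Or.inl ⟨_, _, hp⟩)
      · exact Or.inr ⟨⟨_, hp⟩, ⟨_, hq⟩⟩
      · exact Or.inl (Or.inr ⟨_, _, hq⟩)
  | star e he =>
    have hfirst := mem_firsts_iff (star e) y
    simp only [firsts, lang] at hfirst
    simp only [follows, lang, Finset.mem_union, Finset.mem_product]
    constructor
    · rintro (h | ⟨h1, h2⟩)
      · obtain ⟨u, v, h⟩ := he.1 h
        exact ⟨u, v, Language.mem_kstar.2 ⟨[u ++ x :: y :: v], by simp, by simpa using h⟩⟩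
      · obtain ⟨u, hu⟩ := (mem_lasts_iff _ _).1 h1
        obtain ⟨v, hv⟩ := (mem_firsts_iff _ _).1 h2
        refine ⟨u, v, Language.mem_kstar.2 ⟨[u ++ [x], y :: v], by simp, ?_⟩⟩
        simp [hu, hv]
    · rintro ⟨u, v, h⟩
      obtain ⟨L, hL, hL'⟩ := Language.mem_kstar.1 h
      clear h
      induction L generalizing u with
      | nil => simp at hL
      | cons p L ih =>
        rw [List.flatten_cons] at hL
        rcases append_eq_append_cons_cons hL.symm with ⟨v', rfl⟩ | ⟨rfl, h2⟩ | ⟨u', h2⟩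
        · exact Or.inl (he.2 ⟨u, v', hL' _ (by simp)⟩)
        · refine Or.inr ⟨(mem_lasts_iff _ _).2 ⟨u, hL' _ (by simp)⟩, hfirst.2 ⟨v, ?_⟩⟩
          exact Language.mem_kstar.2 ⟨L, h2.symm, fun z hz => hL' z (by simp [hz])⟩
        · exact ih u' h2.symm fun z hz => hL' z (by simp [hz])

end RegEx

namespace RegEx

variable {A : Type}

/-- The number of first positions. -/
def numFirst : RegEx A → ℕ
  | eps => 0
  | char _ => 1
  | plus l r => numFirst l + numFirst r
  | cat l r => numFirst l + if nullable l then numFirst r else 0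
  | star e => numFirst e

/-- The number of last positions. -/
def numLast : RegEx A → ℕ
  | eps => 0
  | char _ => 1
  | plus l r => numLast l + numLast r
  | cat l r => numLast r + if nullable r then numLast l else 0
  | star e => numLast e

/-- The numbers of pairs of positions that are consecutive in some word of the language of the
expression, respectively of its star. -/
def followCounts : RegEx A → ℕ × ℕ
  | eps => (0, 0)
  | char _ => (0, 1)
  | plus l r => ((followCounts l).1 + (followCounts r).1,
      (followCounts l).2 + (followCounts r).2 + numLast l * numFirst r + numLast r * numFirst l)
  | cat l r => ((followCounts l).1 + (followCounts r).1 + numLast l * numFirst r,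
      (if nullable r then (followCounts l).2 else (followCounts l).1) +
      (if nullable l then (followCounts r).2 else (followCounts r).1) +
      numLast l * numFirst r + numLast r * numFirst l)
  | star e => ((followCounts e).2, (followCounts e).2)

/-- In a linear expression no letter occurs twice. -/
def Linear [DecidableEq A] : RegEx A → Prop
  | eps => True
  | char _ => True
  | plus l r => Linear l ∧ Linear r ∧ Disjoint (syms l) (syms r)
  | cat l r => Linear l ∧ Linear r ∧ Disjoint (syms l) (syms r)
  | star e => Linear e

section Linear

variable [DecidableEq A]

lemma firsts_subset (e : RegEx A) : firsts e ⊆ syms e := by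
  induction e with
  | eps | char => exact Finset.Subset.refl _
  | plus l r hl hr => exact Finset.union_subset_union hl hr
  | cat l r hl hr =>
    refine Finset.union_subset_union hl ?_
    split_ifs
    · exact hr
    · exact Finset.empty_subset _
  | star e he => exact he

lemma lasts_subset (e : RegEx A) : lasts e ⊆ syms e := by
  induction e with
  | eps | char => exact Finset.Subset.refl _
  | plus l r hl hr => exact Finset.union_subset_union hl hr
  | cat l r hl hr =>
    simp only [lasts, syms]
    rw [Finset.union_comm (syms l)]
    refine Finset.union_subset_union hr ?_
    split_ifs
    · exact hl
    · exact Finset.empty_subset _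
  | star e he => exact he

lemma follows_subset (e : RegEx A) : follows e ⊆ syms e ×ˢ syms e := by
  induction e with
  | eps | char => exact Finset.empty_subset _
  | plus l r hl hr =>
    exact Finset.union_subset
      (hl.trans (Finset.product_subset_product Finset.subset_union_left Finset.subset_union_left))
      (hr.trans (Finset.product_subset_product Finset.subset_union_right Finset.subset_union_right))
  | cat l r hl hr =>
    exact Finset.union_subset (Finset.union_subset
      (hl.trans (Finset.product_subset_product Finset.subset_union_left Finset.subset_union_left))
      (hr.trans (Finset.product_subset_product Finset.subset_union_right Finset.subset_union_right)))
      (Finset.product_subset_product ((lasts_subset l).trans Finset.subset_union_left)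
        ((firsts_subset r).trans Finset.subset_union_right))
  | star e he =>
    exact Finset.union_subset he (Finset.product_subset_product (lasts_subset e) (firsts_subset e))

lemma followsStar_subset (e : RegEx A) :
    follows e ∪ lasts e ×ˢ firsts e ⊆ syms e ×ˢ syms e :=
  follows_subset (star e)

lemma card_firsts {e : RegEx A} (h : Linear e) : (firsts e).card = numFirst e := by
  induction e with
  | eps | char => rfl
  | plus l r hl hr =>
    rw [firsts, Finset.card_union_of_disjoint
      (h.2.2.mono (firsts_subset l) (firsts_subset r)), hl h.1, hr h.2.1, numFirst]
  | cat l r hl hr =>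
    rw [firsts, numFirst]
    split_ifs
    · rw [Finset.card_union_of_disjoint
        (h.2.2.mono (firsts_subset l) (firsts_subset r)), hl h.1, hr h.2.1]
    · rw [Finset.union_empty, hl h.1, add_zero]
  | star e he => exact he h

lemma card_lasts {e : RegEx A} (h : Linear e) : (lasts e).card = numLast e := by
  induction e with
  | eps | char => rfl
  | plus l r hl hr =>
    rw [lasts, Finset.card_union_of_disjoint
      (h.2.2.mono (lasts_subset l) (lasts_subset r)), hl h.1, hr h.2.1, numLast]
  | cat l r hl hr =>
    rw [lasts, numLast]
    split_ifs
    · rw [Finset.card_union_of_disjoint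
        (h.2.2.symm.mono (lasts_subset r) (lasts_subset l)), hl h.1, hr h.2.1]
    · rw [Finset.union_empty, hr h.2.1, add_zero]
  | star e he => exact he h

lemma card_union_blocks {B : Type*} [DecidableEq B] {S T : Finset B} (h : Disjoint S T)
    {P Q M N : Finset (B × B)} (hP : P ⊆ S ×ˢ S) (hQ : Q ⊆ T ×ˢ T) (hM : M ⊆ S ×ˢ T)
    (hN : N ⊆ T ×ˢ S) : (P ∪ Q ∪ M ∪ N).card = P.card + Q.card + M.card + N.card := by
  rw [Finset.card_union_of_disjoint, Finset.card_union_of_disjoint,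
    Finset.card_union_of_disjoint]
  · exact (Finset.disjoint_product.2 (Or.inl h)).mono hP hQ
  · exact Finset.disjoint_union_left.2 ⟨(Finset.disjoint_product.2 (Or.inr h)).mono hP hM,
      (Finset.disjoint_product.2 (Or.inl h.symm)).mono hQ hM⟩
  · exact Finset.disjoint_union_left.2 ⟨Finset.disjoint_union_left.2
      ⟨(Finset.disjoint_product.2 (Or.inl h)).mono hP hN,
        (Finset.disjoint_product.2 (Or.inr h.symm)).mono hQ hN⟩,
      (Finset.disjoint_product.2 (Or.inl h)).mono hM hN⟩

lemma card_follows {e : RegEx A} (h : Linear e) :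
    (follows e).card = (followCounts e).1 ∧
      (follows e ∪ lasts e ×ˢ firsts e).card = (followCounts e).2 := by
  induction e with
  | eps => exact ⟨rfl, rfl⟩
  | char a => exact ⟨rfl, rfl⟩
  | plus l r hl hr =>
    obtain ⟨h1, h2, hd⟩ := h
    obtain ⟨hl1, hl2⟩ := hl h1
    obtain ⟨hr1, hr2⟩ := hr h2
    constructor
    · have := card_union_blocks hd (follows_subset l) (follows_subset r)
        (Finset.empty_subset _) (Finset.empty_subset _)
      simpa [follows, followCounts, hl1, hr1] using this
    · have := card_union_blocks hd (followsStar_subset l) (followsStar_subset r)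
        (Finset.product_subset_product (lasts_subset l) (firsts_subset r))
        (Finset.product_subset_product (lasts_subset r) (firsts_subset l))
      rw [Finset.card_product, Finset.card_product, hl2, hr2, card_lasts h1, card_lasts h2,
        card_firsts h1, card_firsts h2] at this
      rw [followCounts, ← this]
      congr 1
      ext ⟨x, y⟩
      simp only [follows, lasts, firsts, Finset.mem_union, Finset.mem_product]
      tauto
  | cat l r hl hr =>
    obtain ⟨h1, h2, hd⟩ := h
    obtain ⟨hl1, hl2⟩ := hl h1
    obtain ⟨hr1, hr2⟩ := hr h2
    constructor
    · have := card_union_blocks hd (follows_subset l) (follows_subset r)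
        (Finset.product_subset_product (lasts_subset l) (firsts_subset r)) (Finset.empty_subset _)
      rw [Finset.card_product, hl1, hr1, card_lasts h1, card_firsts h2, Finset.union_empty] at this
      exact this
    · have key : ∀ P Q : Finset (A × A), P ⊆ syms l ×ˢ syms l → Q ⊆ syms r ×ˢ syms r →
          (P ∪ Q ∪ lasts l ×ˢ firsts r ∪ lasts r ×ˢ firsts l).card =
            P.card + Q.card + numLast l * numFirst r + numLast r * numFirst l := by
        intro P Q hP hQ
        rw [card_union_blocks hd hP hQ
          (Finset.product_subset_product (lasts_subset l) (firsts_subset r))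
          (Finset.product_subset_product (lasts_subset r) (firsts_subset l)),
          Finset.card_product, Finset.card_product, card_lasts h1, card_lasts h2,
          card_firsts h1, card_firsts h2]
      have key2 := key (if nullable r then follows l ∪ lasts l ×ˢ firsts l else follows l)
        (if nullable l then follows r ∪ lasts r ×ˢ firsts r else follows r)
        (by split_ifs; exacts [followsStar_subset l, follows_subset l])
        (by split_ifs; exacts [followsStar_subset r, follows_subset r])
      rw [apply_ite Finset.card, apply_ite Finset.card, hl1, hl2, hr1, hr2] at key2
      rw [followCounts, ← key2]
      congr 1
      ext ⟨x, y⟩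
      cases hnl : nullable l <;> cases hnr : nullable r <;>
        simp only [follows, lasts, firsts, Finset.mem_union, Finset.mem_product, hnl, hnr, if_true,
          Finset.notMem_empty, Bool.false_eq_true, if_false] <;> tauto
  | star e he =>
    refine ⟨(he h).2, ?_⟩
    rw [follows, lasts, firsts, Finset.union_assoc, Finset.union_self]
    exact (he h).2

end Linear

section Mark

lemma markAux_plus (l r : RegEx A) (n : ℕ) : markAux (plus l r) n =
    (plus (markAux l n).1 (markAux r (markAux l n).2).1, (markAux r (markAux l n).2).2) := rfl

lemma markAux_cat (l r : RegEx A) (n : ℕ) : markAux (cat l r) n =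
    (cat (markAux l n).1 (markAux r (markAux l n).2).1, (markAux r (markAux l n).2).2) := rfl

lemma markAux_star (e : RegEx A) (n : ℕ) : markAux (star e) n =
    (star (markAux e n).1, (markAux e n).2) := rfl

lemma nullable_markAux (e : RegEx A) (n : ℕ) : nullable (markAux e n).1 = nullable e := by
  induction e generalizing n with
  | eps | char | star => rfl
  | plus l r hl hr | cat l r hl hr =>
    simp [markAux_plus, markAux_cat, nullable, hl, hr]

lemma numFirst_markAux (e : RegEx A) (n : ℕ) : numFirst (markAux e n).1 = numFirst e := by
  induction e generalizing n with
  | eps | char => rfl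
  | plus l r hl hr | cat l r hl hr =>
    simp [markAux_plus, markAux_cat, numFirst, hl, hr, nullable_markAux]
  | star e he => exact he n

lemma numLast_markAux (e : RegEx A) (n : ℕ) : numLast (markAux e n).1 = numLast e := by
  induction e generalizing n with
  | eps | char => rfl
  | plus l r hl hr | cat l r hl hr =>
    simp [markAux_plus, markAux_cat, numLast, hl, hr, nullable_markAux]
  | star e he => exact he n

lemma followCounts_markAux (e : RegEx A) (n : ℕ) :
    followCounts (markAux e n).1 = followCounts e := by
  induction e generalizing n with
  | eps | char => rfl
  | plus l r hl hr | cat l r hl hr =>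
    simp [markAux_plus, markAux_cat, followCounts, hl, hr, nullable_markAux, numFirst_markAux,
      numLast_markAux]
  | star e he => simp [markAux_star, followCounts, he]

lemma le_markAux (e : RegEx A) (n : ℕ) : n ≤ (markAux e n).2 := by
  induction e generalizing n with
  | eps => exact le_rfl
  | char => exact Nat.le_succ n
  | plus l r hl hr | cat l r hl hr => exact (hl n).trans (hr _)
  | star e he => exact he n

variable [DecidableEq A]

lemma mem_syms_markAux {e : RegEx A} {n : ℕ} {x : A × ℕ} (hx : x ∈ syms (markAux e n).1) :
    n < x.2 ∧ x.2 ≤ (markAux e n).2 := by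
  induction e generalizing n with
  | eps => simp [markAux, syms] at hx
  | char =>
    simp only [markAux, syms, Finset.mem_singleton] at hx
    simp [hx, markAux]
  | plus l r hl hr | cat l r hl hr =>
    rcases Finset.mem_union.1 hx with h | h
    · exact ⟨(hl h).1, (hl h).2.trans (le_markAux _ _)⟩
    · exact ⟨(le_markAux _ _).trans_lt (hr h).1, (hr h).2⟩
  | star e he => exact he hx

lemma disjoint_syms_markAux (l r : RegEx A) (n : ℕ) :
    Disjoint (syms (markAux l n).1) (syms (markAux r (markAux l n).2).1) :=
  Finset.disjoint_left.2 fun _ hx hx' =>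
    ((mem_syms_markAux hx).2.trans_lt (mem_syms_markAux hx').1).false

lemma linear_markAux (e : RegEx A) (n : ℕ) : Linear (markAux e n).1 := by
  induction e generalizing n with
  | eps | char => trivial
  | plus l r hl hr | cat l r hl hr => exact ⟨hl _, hr _, disjoint_syms_markAux l r n⟩
  | star e he => exact he n

lemma card_First (e : RegEx A) : Nat.card (First e) = numFirst e := by
  rw [show First e = (firsts (mark e) : Set (A × ℕ)) from
    Set.ext fun x => (mem_firsts_iff _ _).symm, Nat.card_coe_set_eq, Set.ncard_coe_finset,
    mark, card_firsts (linear_markAux e 0), numFirst_markAux]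

lemma card_Follow (e : RegEx A) : Nat.card (Follow e) = (followCounts e).1 := by
  rw [show Follow e = (follows (mark e) : Set ((A × ℕ) × (A × ℕ))) from
    Set.ext fun x => (mem_follows_iff _ x.1 x.2).symm, Nat.card_coe_set_eq, Set.ncard_coe_finset,
    mark, (card_follows (linear_markAux e 0)).1, followCounts_markAux]

lemma finite_First (e : RegEx A) : (First e).Finite := by
  rw [show First e = (firsts (mark e) : Set (A × ℕ)) from
    Set.ext fun x => (mem_firsts_iff _ _).symm]
  exact Finset.finite_toSet _

lemma finite_Follow (e : RegEx A) : (Follow e).Finite := by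
  rw [show Follow e = (follows (mark e) : Set ((A × ℕ) × (A × ℕ))) from
    Set.ext fun x => (mem_follows_iff _ x.1 x.2).symm]
  exact Finset.finite_toSet _

end Mark

end RegEx

namespace RegEx

variable {A : Type}

namespace IsUnionOfLetters

lemma nullable_eq {e : RegEx A} {l : List A} (h : IsUnionOfLetters e l) : nullable e = false := by
  induction h with
  | char a => rfl
  | plus _ _ hl hr => simp [nullable, hl, hr]

lemma numFirst_eq {e : RegEx A} {l : List A} (h : IsUnionOfLetters e l) :
    numFirst e = l.length := by
  induction h with
  | char a => rfl
  | plus _ _ hl hr => simp [numFirst, hl, hr]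

lemma numLast_eq {e : RegEx A} {l : List A} (h : IsUnionOfLetters e l) :
    numLast e = l.length := by
  induction h with
  | char a => rfl
  | plus _ _ hl hr => simp [numLast, hl, hr]

lemma followCounts_eq {e : RegEx A} {l : List A} (h : IsUnionOfLetters e l) :
    followCounts e = (0, l.length ^ 2) := by
  induction h with
  | char a => rfl
  | plus h1 h2 hl hr =>
    simp only [followCounts, hl, hr, h1.numFirst_eq, h2.numFirst_eq, h1.numLast_eq, h2.numLast_eq,
      List.length_append, Prod.mk.injEq, true_and]
    ring

lemma size_eq {e : RegEx A} {l : List A} (h : IsUnionOfLetters e l) :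
    size e + 1 = 2 * l.length := by
  induction h with
  | char a => rfl
  | plus _ _ hl hr => simp only [size, List.length_append]; omega

lemma not_isSigmaStar [Fintype A] {e : RegEx A} {l : List A} (h : IsUnionOfLetters e l) :
    ¬ IsSigmaStar e := by
  rintro ⟨f, l', rfl, -⟩
  cases h

lemma avoids [Fintype A] {e : RegEx A} {l : List A} (h : IsUnionOfLetters e l) : Avoids e := by
  induction h with
  | char a => trivial
  | plus h1 h2 hl hr => exact ⟨hl, hr, h1.not_isSigmaStar, h2.not_isSigmaStar⟩

end IsUnionOfLetters

namespace IsSigmaStar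

variable [Fintype A] {e : RegEx A}

lemma exists_union (h : IsSigmaStar e) :
    ∃ (f : RegEx A) (l : List A), e = star f ∧ IsUnionOfLetters f l ∧
      l.length = Fintype.card A := by
  classical
  obtain ⟨f, l, rfl, hf, hl, ha⟩ := h
  refine ⟨f, l, rfl, hf, ?_⟩
  rw [← List.toFinset_card_of_nodup hl, ← Finset.card_univ]
  congr 1
  ext a
  simpa using ha a

lemma nullable_eq (h : IsSigmaStar e) : nullable e = true := by
  obtain ⟨f, l, rfl, -⟩ := h
  rfl

lemma numFirst_eq (h : IsSigmaStar e) : numFirst e = Fintype.card A := by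
  obtain ⟨f, l, rfl, hf, hl⟩ := h.exists_union
  rw [numFirst, hf.numFirst_eq, hl]

lemma numLast_eq (h : IsSigmaStar e) : numLast e = Fintype.card A := by
  obtain ⟨f, l, rfl, hf, hl⟩ := h.exists_union
  rw [numLast, hf.numLast_eq, hl]

lemma followCounts_eq (h : IsSigmaStar e) :
    followCounts e = (Fintype.card A ^ 2, Fintype.card A ^ 2) := by
  obtain ⟨f, l, rfl, hf, hl⟩ := h.exists_union
  rw [followCounts, hf.followCounts_eq, hl]

lemma size_eq (h : IsSigmaStar e) : size e = 2 * Fintype.card A := by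
  obtain ⟨f, l, rfl, hf, hl⟩ := h.exists_union
  rw [size, hf.size_eq, hl]

lemma avoids (h : IsSigmaStar e) : Avoids e := by
  obtain ⟨f, l, rfl, hf, -⟩ := h
  exact hf.avoids

end IsSigmaStar

/-- The shape of a union of letters. -/
def shape : RegEx A → BinaryTree Unit
  | plus l r => .node () (shape l) (shape r)
  | _ => .nil

lemma IsUnionOfLetters.numNodes_shape {e : RegEx A} {l : List A} (h : IsUnionOfLetters e l) :
    (shape e).numNodes + 1 = l.length := by
  induction h with
  | char a => rfl
  | plus _ _ hl hr => simp only [shape, BinaryTree.numNodes, List.length_append]; omega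

lemma IsUnionOfLetters.eq_of_shape_eq {e e' : RegEx A} {l l' : List A}
    (h : IsUnionOfLetters e l) (h' : IsUnionOfLetters e' l') (hs : shape e = shape e')
    (hl : l = l') : e = e' := by
  induction h generalizing e' l' with
  | char a =>
    cases h' with
    | char b => simpa using hl
    | plus => simp [shape] at hs
  | plus h1 h2 ih1 ih2 =>
    cases h' with
    | char b => simp [shape] at hs
    | plus h3 h4 =>
      simp only [shape, BinaryTree.node.injEq, true_and] at hs
      have hlen := congrArg BinaryTree.numNodes hs.1
      have h5 := h1.numNodes_shape
      have h6 := h3.numNodes_shape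
      obtain ⟨e1, e2⟩ := List.append_inj hl (by omega)
      rw [ih1 h3 hs.1 e1, ih2 h4 hs.2 e2]

lemma finite_size_le [Finite A] (n : ℕ) : {e : RegEx A | size e ≤ n}.Finite := by
  induction n with
  | zero =>
    refine Set.Finite.subset Set.finite_empty fun e he => ?_
    cases e <;> simp [size] at he
  | succ n ih =>
    refine ((((Set.finite_range (char (A := A))).insert eps).union
      (ih.image star)).union ((ih.image2 plus ih).union (ih.image2 cat ih))).subset fun e he => ?_
    simp only [Set.mem_ofPred_eq] at he
    cases e with
    | eps => simp
    | char a => simp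
    | plus l r =>
      simp only [size] at he
      exact Or.inr (Or.inl ⟨l, show size l ≤ n by omega, r, show size r ≤ n by omega, rfl⟩)
    | cat l r =>
      simp only [size] at he
      exact Or.inr (Or.inr ⟨l, show size l ≤ n by omega, r, show size r ≤ n by omega, rfl⟩)
    | star e =>
      simp only [size] at he
      exact Or.inl (Or.inr ⟨e, show size e ≤ n by omega, rfl⟩)

/-- The number of expressions matching the absorbing pattern. -/
noncomputable def numSigmaStar (A : Type) [Fintype A] : ℕ :=
  Set.ncard {e : RegEx A | IsSigmaStar e}

lemma catalan_le (n : ℕ) : catalan n ≤ 4 ^ n := by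
  have h1 := succ_mul_catalan_eq_centralBinom n
  have h2 := Nat.centralBinom_le_four_pow n
  nlinarith [Nat.zero_le (n * catalan n)]

lemma numSigmaStar_le [Fintype A] :
    numSigmaStar A ≤ 4 ^ (Fintype.card A - 1) * Fintype.card A ^ Fintype.card A := by
  classical
  choose f l h1 h2 h3 using fun e : {e : RegEx A // IsSigmaStar e} => e.2.exists_union
  have hinj : Function.Injective fun e : {e : RegEx A // IsSigmaStar e} =>
      ((⟨shape (f e), BinaryTree.mem_treesOfNumNodesEq.2
        (by have := (h2 e).numNodes_shape; have := h3 e; omega)⟩, ⟨l e, h3 e⟩) :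
        (BinaryTree.treesOfNumNodesEq (Fintype.card A - 1)) × List.Vector A (Fintype.card A)) := by
    intro e e' h
    have := (h2 e).eq_of_shape_eq (h2 e') (congrArg (fun p => p.1.1) h)
      (congrArg (fun p => p.2.1) h)
    exact Subtype.ext ((h1 e).trans ((congrArg star this).trans (h1 e').symm))
  have := Nat.card_le_card_of_injective _ hinj
  rw [Nat.card_prod, Nat.card_eq_fintype_card (α := List.Vector _ _), card_vector,
    Nat.card_eq_finsetCard, BinaryTree.treesOfNumNodesEq_card_eq_catalan] at this
  rw [numSigmaStar, ← Nat.card_coe_set_eq]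
  exact this.trans (Nat.mul_le_mul_right _ (catalan_le _))

end RegEx

namespace RegEx

open PowerSeries

variable (A : Type) [Fintype A]

/-- The expressions of size `n` in which the absorbing pattern is no argument of a union. -/
noncomputable def avoiders (n : ℕ) : Finset (RegEx A) :=
  ((finite_size_le (A := A) n).subset
    (fun _ he => he.2.le : {e : RegEx A | Avoids e ∧ size e = n} ⊆ _)).toFinset

lemma mem_avoiders {n : ℕ} {e : RegEx A} : e ∈ avoiders A n ↔ Avoids e ∧ size e = n := by
  simp [avoiders]

/-- The pairs of expressions of total size `n` in which the absorbing pattern is no argument of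
a union. -/
noncomputable def avoiderPairs (n : ℕ) : Finset (RegEx A × RegEx A) :=
  (((finite_size_le (A := A) n).prod (finite_size_le (A := A) n)).subset
    (t := {p : RegEx A × RegEx A | Avoids p.1 ∧ Avoids p.2 ∧ size p.1 + size p.2 = n})
    fun _ hp => Set.mem_prod.2
      ⟨le_of_add_le_left hp.2.2.le, le_of_add_le_right hp.2.2.le⟩).toFinset

lemma mem_avoiderPairs {n : ℕ} {p : RegEx A × RegEx A} :
    p ∈ avoiderPairs A n ↔ Avoids p.1 ∧ Avoids p.2 ∧ size p.1 + size p.2 = n := by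
  simp [avoiderPairs]

/-- The generating function of a cost function on expressions. -/
noncomputable def costSeries (φ : RegEx A → ℝ) : ℝ⟦X⟧ :=
  mk fun n => ∑ e ∈ avoiders A n, φ e

/-- The generating function of a cost function on pairs of expressions. -/
noncomputable def pairSeries (ψ : RegEx A → RegEx A → ℝ) : ℝ⟦X⟧ :=
  mk fun n => ∑ p ∈ avoiderPairs A n, ψ p.1 p.2

variable {A}

lemma coeff_costSeries (φ : RegEx A → ℝ) (n : ℕ) :
    coeff n (costSeries A φ) = ∑ e ∈ avoiders A n, φ e := coeff_mk _ _

lemma costSeries_sub (φ χ : RegEx A → ℝ) :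
    costSeries A (fun e => φ e - χ e) = costSeries A φ - costSeries A χ := by
  ext n; simp [coeff_costSeries, Finset.sum_sub_distrib]

lemma costSeries_const_mul (c : ℝ) (φ : RegEx A → ℝ) :
    costSeries A (fun e => c * φ e) = C c * costSeries A φ := by
  ext n; simp [coeff_costSeries, Finset.mul_sum]

lemma pairSeries_add (φ χ : RegEx A → RegEx A → ℝ) :
    pairSeries A (fun l r => φ l r + χ l r) = pairSeries A φ + pairSeries A χ := by
  ext n; simp [pairSeries, Finset.sum_add_distrib]

lemma pairSeries_sub (φ χ : RegEx A → RegEx A → ℝ) :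
    pairSeries A (fun l r => φ l r - χ l r) = pairSeries A φ - pairSeries A χ := by
  ext n; simp [pairSeries, Finset.sum_sub_distrib]

lemma pairSeries_mul (φ χ : RegEx A → ℝ) :
    pairSeries A (fun l r => φ l * χ r) = costSeries A φ * costSeries A χ := by
  classical
  ext n
  rw [coeff_mul, pairSeries, coeff_mk]
  rw [← Finset.sum_fiberwise_of_maps_to (s := avoiderPairs A n)
    (t := Finset.HasAntidiagonal.antidiagonal n) (g := fun p => (size p.1, size p.2))
    (fun p hp => Finset.HasAntidiagonal.mem_antidiagonal.2 ((mem_avoiderPairs A).1 hp).2.2)]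
  refine Finset.sum_congr rfl fun q hq => ?_
  rw [coeff_costSeries, coeff_costSeries, Finset.sum_mul_sum, ← Finset.sum_product']
  refine Finset.sum_congr ?_ fun _ _ => rfl
  ext p
  have hq' := Finset.HasAntidiagonal.mem_antidiagonal.1 hq
  simp only [Finset.mem_filter, mem_avoiderPairs, Finset.mem_product, mem_avoiders, Prod.ext_iff]
  constructor
  · rintro ⟨⟨h1, h2, -⟩, h3, h4⟩
    exact ⟨⟨h1, h3⟩, h2, h4⟩
  · rintro ⟨⟨h1, h3⟩, h2, h4⟩
    exact ⟨⟨h1, h2, by rw [h3, h4, hq']⟩, h3, h4⟩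

open Classical in
/-- The indicator function of the absorbing pattern. -/
noncomputable def absorbing (e : RegEx A) : ℝ := if IsSigmaStar e then 1 else 0

lemma avoiders_zero : avoiders A 0 = ∅ := by
  ext e
  simp only [mem_avoiders, Finset.notMem_empty, iff_false]
  cases e <;> simp [size]

lemma costSeries_eq (φ : RegEx A → ℝ) :
    costSeries A φ = X * (C (φ eps + ∑ a, φ (char a)) + costSeries A (fun e => φ (star e)) +
      pairSeries A (fun l r => φ (cat l r)) +
      pairSeries A (fun l r => (1 - absorbing l) * (1 - absorbing r) * φ (plus l r))) := by
  classical
  ext n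
  cases n with
  | zero => simp [coeff_costSeries, avoiders_zero]
  | succ n =>
    rw [coeff_succ_X_mul, coeff_costSeries]
    simp only [map_add, coeff_costSeries, pairSeries, coeff_mk, coeff_C]
    have hset : avoiders A (n + 1) =
        ((if n = 0 then insert eps (Finset.univ.image char) else ∅) ∪
          (avoiders A n).image star ∪ (avoiderPairs A n).image (fun p => cat p.1 p.2)) ∪
        ((avoiderPairs A n).filter fun p => ¬ IsSigmaStar p.1 ∧ ¬ IsSigmaStar p.2).image
          (fun p => plus p.1 p.2) := by
      ext e
      simp only [mem_avoiders, Finset.mem_union, Finset.mem_image, mem_avoiderPairs,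
        Finset.mem_filter, Prod.exists]
      cases e with
      | eps => split_ifs with h <;> simp [Avoids, size, h, eq_comm]
      | char a => split_ifs with h <;> simp [Avoids, size, h, eq_comm]
      | plus l r =>
        have : plus l r ∉ (if n = 0 then insert eps (Finset.univ.image char) else ∅ :
            Finset (RegEx A)) := by split_ifs <;> simp
        simp only [this, Avoids, size, plus.injEq, reduceCtorEq, and_false, exists_false, false_or]
        constructor
        · rintro ⟨⟨h1, h2, h3, h4⟩, h5⟩
          exact ⟨l, r, ⟨⟨h1, h2, by omega⟩, h3, h4⟩, rfl, rfl⟩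
        · rintro ⟨l', r', ⟨⟨h1, h2, h5⟩, h3, h4⟩, rfl, rfl⟩
          exact ⟨⟨h1, h2, h3, h4⟩, by simpa using h5⟩
      | cat l r =>
        have : cat l r ∉ (if n = 0 then insert eps (Finset.univ.image char) else ∅ :
            Finset (RegEx A)) := by split_ifs <;> simp
        simp only [this, Avoids, size, cat.injEq, reduceCtorEq, and_false, exists_false, false_or,
          or_false]
        constructor
        · rintro ⟨⟨h1, h2⟩, h5⟩
          exact ⟨l, r, ⟨h1, h2, by omega⟩, rfl, rfl⟩
        · rintro ⟨l', r', ⟨h1, h2, h5⟩, rfl, rfl⟩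
          exact ⟨⟨h1, h2⟩, by simpa using h5⟩
      | star e =>
        have : star e ∉ (if n = 0 then insert eps (Finset.univ.image char) else ∅ :
            Finset (RegEx A)) := by split_ifs <;> simp
        simp [this, Avoids, size]
    rw [hset, Finset.sum_union, Finset.sum_union, Finset.sum_union]
    · congr 1
      · congr 1
        · congr 1
          · split_ifs with h
            · rw [Finset.sum_insert (by simp),
                Finset.sum_image fun a _ b _ hab => char.inj hab]
            · simp
          · rw [Finset.sum_image (by simp)]
        · rw [Finset.sum_image]
          rintro ⟨a, b⟩ - ⟨c, d⟩ - h
          simpa using h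
      · rw [Finset.sum_image, Finset.sum_filter]
        · refine Finset.sum_congr rfl fun p _ => ?_
          by_cases h1 : IsSigmaStar p.1 <;> by_cases h2 : IsSigmaStar p.2 <;>
            simp [absorbing, h1, h2]
        · rintro ⟨a, b⟩ - ⟨c, d⟩ - h
          simpa using h
    all_goals
      split_ifs with hn <;> rw [Finset.disjoint_left] <;> intro e <;> cases e <;> simp

end RegEx

namespace RegEx

open PowerSeries

variable (A : Type) [Fintype A]

/-- Generating function of the number of expressions. -/
noncomputable def countSeries : ℝ⟦X⟧ := costSeries A fun _ => 1

/-- Generating function of the absorbing pattern. -/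
noncomputable def absorbingSeries : ℝ⟦X⟧ := costSeries A absorbing

/-- Generating function of the expressions whose language does not contain the empty word. -/
noncomputable def nonNullSeries : ℝ⟦X⟧ := costSeries A fun e => if nullable e then 0 else 1

/-- Generating function of the number of first positions. -/
noncomputable def firstSeries : ℝ⟦X⟧ := costSeries A fun e => numFirst e

/-- Generating function of the number of last positions. -/
noncomputable def lastSeries : ℝ⟦X⟧ := costSeries A fun e => numLast e

/-- Generating function of the number of consecutive pairs of positions. -/
noncomputable def followSeries : ℝ⟦X⟧ := costSeries A fun e => (followCounts e).1

/-- Generating function of the number of pairs of positions consecutive in the star. -/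
noncomputable def followStarSeries : ℝ⟦X⟧ := costSeries A fun e => (followCounts e).2

lemma costSeries_nullable : costSeries A (fun e => if nullable e then 1 else 0) =
    countSeries A - nonNullSeries A := by
  rw [countSeries, nonNullSeries, ← costSeries_sub]
  congr 1; ext e
  split_ifs <;> simp

lemma costSeries_not_absorbing_mul {φ : RegEx A → ℝ} {c : ℝ}
    (h : ∀ e, IsSigmaStar e → φ e = c) :
    costSeries A (fun e => (1 - absorbing e) * φ e) =
      costSeries A φ - C c * absorbingSeries A := by
  rw [absorbingSeries, ← costSeries_const_mul, ← costSeries_sub]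
  congr 1; ext e
  by_cases he : IsSigmaStar e
  · simp [absorbing, he, h e he]
  · simp [absorbing, he]

lemma costSeries_not_absorbing :
    costSeries A (fun e => 1 - absorbing e) = countSeries A - absorbingSeries A := by
  rw [costSeries_sub]; rfl

lemma absorbingSeries_eq :
    absorbingSeries A = C (numSigmaStar A : ℝ) * X ^ (2 * Fintype.card A) := by
  classical
  ext n
  rw [absorbingSeries, coeff_costSeries, coeff_C_mul, coeff_X_pow]
  split_ifs with h
  · have : ((avoiders A n).filter IsSigmaStar : Set (RegEx A)) = {e | IsSigmaStar e} := by
      ext e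
      simp only [Finset.coe_filter, mem_avoiders, Set.mem_ofPred_eq, and_iff_right_iff_imp]
      exact fun he => ⟨he.avoids, he.size_eq.trans h.symm⟩
    simp only [absorbing]
    rw [Finset.sum_boole, numSigmaStar, ← this, Set.ncard_coe_finset, mul_one]
  · rw [mul_zero]
    refine Finset.sum_eq_zero fun e he => ?_
    rw [absorbing, if_neg]
    intro hs
    exact h (((mem_avoiders A).1 he).2.symm.trans hs.size_eq)

lemma countSeries_eq : countSeries A = X * (C (Fintype.card A + 1 : ℝ) + countSeries A +
    countSeries A ^ 2 + (countSeries A - absorbingSeries A) ^ 2) := by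
  conv_lhs => rw [countSeries, costSeries_eq]
  have h1 := pairSeries_mul (A := A) (fun _ => 1) (fun _ => 1)
  have h2 := pairSeries_mul (A := A) (fun e => 1 - absorbing e) (fun e => 1 - absorbing e)
  simp only [mul_one] at h1 h2 ⊢
  rw [h1, h2, costSeries_not_absorbing]
  simp only [Finset.sum_const, Finset.card_univ, nsmul_eq_mul, mul_one, add_comm (1 : ℝ),
    countSeries]
  ring

lemma nonNullSeries_eq : nonNullSeries A = X * (C (Fintype.card A : ℝ) +
    2 * countSeries A * nonNullSeries A) := by
  conv_lhs => rw [nonNullSeries, costSeries_eq]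
  have h1 : (fun l r : RegEx A => if nullable (cat l r) then (0 : ℝ) else 1) =
      fun l r => 1 * 1 - (if nullable l then 1 else 0) * (if nullable r then 1 else 0) := by
    ext l r
    cases hl : nullable l <;> cases hr : nullable r <;> simp [nullable, hl, hr]
  have h2 : (fun l r : RegEx A => (1 - absorbing l) * (1 - absorbing r) *
      if nullable (plus l r) then (0 : ℝ) else 1) =
      fun l r => (if nullable l then 0 else 1) * (if nullable r then 0 else 1) := by
    have h3 : ∀ e : RegEx A, nullable e = false → absorbing e = 0 := by
      intro e he
      rw [absorbing, if_neg]
      intro hs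
      simp [hs.nullable_eq] at he
    ext l r
    cases hl : nullable l <;> cases hr : nullable r <;> simp [nullable, hl, hr, h3]
  rw [h1, h2, pairSeries_sub, pairSeries_mul (fun _ => 1) (fun _ => 1), pairSeries_mul,
    pairSeries_mul, costSeries_nullable]
  have h4 : costSeries A (fun e => if nullable (star e) then (0 : ℝ) else 1) = 0 := by
    ext n; simp [coeff_costSeries, nullable]
  rw [h4]
  simp only [nullable, if_true, Finset.sum_const, Finset.card_univ, nsmul_eq_mul, mul_one,
    Bool.false_eq_true, if_false, zero_add, add_zero]
  rw [← countSeries, ← nonNullSeries]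
  ring

private lemma plus_split (a b u v : ℝ) : u * v * (a + b) = u * a * v + u * (v * b) := by ring

lemma firstSeries_eq : firstSeries A = X * (C (Fintype.card A : ℝ) + firstSeries A +
    (firstSeries A * countSeries A + (countSeries A - nonNullSeries A) * firstSeries A) +
    2 * (firstSeries A - C (Fintype.card A : ℝ) * absorbingSeries A) *
      (countSeries A - absorbingSeries A)) := by
  conv_lhs => rw [firstSeries, costSeries_eq]
  have h1 : (fun l r : RegEx A => (numFirst (cat l r) : ℝ)) =
      fun l r => (numFirst l : ℝ) * 1 + (if nullable l then 1 else 0) * (numFirst r : ℝ) := by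
    ext l r
    cases hl : nullable l <;> simp [numFirst, hl]
  have h2 : (fun l r : RegEx A => (1 - absorbing l) * (1 - absorbing r) *
      (numFirst (plus l r) : ℝ)) =
      fun l r => (1 - absorbing l) * numFirst l * (1 - absorbing r) +
        (1 - absorbing l) * ((1 - absorbing r) * numFirst r) := by
    ext l r
    simp only [numFirst, Nat.cast_add, plus_split]
  rw [h1, h2, pairSeries_add, pairSeries_add, pairSeries_mul _ (fun _ => 1),
    pairSeries_mul (fun e => if nullable e then 1 else 0),
    pairSeries_mul (fun e => (1 - absorbing e) * numFirst e) (fun e => 1 - absorbing e),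
    pairSeries_mul (fun e => 1 - absorbing e) (fun e => (1 - absorbing e) * numFirst e),
    costSeries_nullable, costSeries_not_absorbing,
    costSeries_not_absorbing_mul A (c := Fintype.card A) fun e he => by rw [he.numFirst_eq]]
  simp only [numFirst, Finset.sum_const, Finset.card_univ, nsmul_eq_mul, mul_one, Nat.cast_one,
    Nat.cast_zero, zero_add]
  rw [← firstSeries, ← countSeries]
  ring

lemma lastSeries_eq : lastSeries A = X * (C (Fintype.card A : ℝ) + lastSeries A +
    (lastSeries A * countSeries A + (countSeries A - nonNullSeries A) * lastSeries A) +
    2 * (lastSeries A - C (Fintype.card A : ℝ) * absorbingSeries A) *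
      (countSeries A - absorbingSeries A)) := by
  conv_lhs => rw [lastSeries, costSeries_eq]
  have h1 : (fun l r : RegEx A => (numLast (cat l r) : ℝ)) =
      fun l r => 1 * (numLast r : ℝ) + (numLast l : ℝ) * (if nullable r then 1 else 0) := by
    ext l r
    cases hr : nullable r <;> simp [numLast, hr]
  have h2 : (fun l r : RegEx A => (1 - absorbing l) * (1 - absorbing r) *
      (numLast (plus l r) : ℝ)) =
      fun l r => (1 - absorbing l) * numLast l * (1 - absorbing r) +
        (1 - absorbing l) * ((1 - absorbing r) * numLast r) := by
    ext l r
    simp only [numLast, Nat.cast_add, plus_split]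
  rw [h1, h2, pairSeries_add, pairSeries_add, pairSeries_mul (fun _ => 1),
    pairSeries_mul _ (fun e => if nullable e then 1 else 0),
    pairSeries_mul (fun e => (1 - absorbing e) * numLast e) (fun e => 1 - absorbing e),
    pairSeries_mul (fun e => 1 - absorbing e) (fun e => (1 - absorbing e) * numLast e),
    costSeries_nullable, costSeries_not_absorbing,
    costSeries_not_absorbing_mul A (c := Fintype.card A) fun e he => by rw [he.numLast_eq]]
  simp only [numLast, Finset.sum_const, Finset.card_univ, nsmul_eq_mul, mul_one, Nat.cast_one,
    Nat.cast_zero, zero_add]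
  rw [← lastSeries, ← countSeries]
  ring

lemma followSeries_eq : followSeries A = X * (followStarSeries A +
    (2 * followSeries A * countSeries A + lastSeries A * firstSeries A) +
    2 * (followSeries A - C ((Fintype.card A : ℝ) ^ 2) * absorbingSeries A) *
      (countSeries A - absorbingSeries A)) := by
  conv_lhs => rw [followSeries, costSeries_eq]
  have h1 : (fun l r : RegEx A => ((followCounts (cat l r)).1 : ℝ)) =
      fun l r => ((followCounts l).1 : ℝ) * 1 + 1 * ((followCounts r).1 : ℝ) +
        numLast l * numFirst r := by
    ext l r
    simp [followCounts]
  have h2 : (fun l r : RegEx A => (1 - absorbing l) * (1 - absorbing r) *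
      ((followCounts (plus l r)).1 : ℝ)) =
      fun l r => (1 - absorbing l) * ((followCounts l).1 : ℝ) * (1 - absorbing r) +
        (1 - absorbing l) * ((1 - absorbing r) * ((followCounts r).1 : ℝ)) := by
    ext l r
    simp only [followCounts, Nat.cast_add, plus_split]
  rw [h1, h2, pairSeries_add, pairSeries_add, pairSeries_add, pairSeries_mul _ (fun _ => 1),
    pairSeries_mul (fun _ => 1), pairSeries_mul,
    pairSeries_mul (fun e => (1 - absorbing e) * ((followCounts e).1 : ℝ))
      (fun e => 1 - absorbing e),
    pairSeries_mul (fun e => 1 - absorbing e)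
      (fun e => (1 - absorbing e) * ((followCounts e).1 : ℝ)),
    costSeries_not_absorbing,
    costSeries_not_absorbing_mul A (c := (Fintype.card A : ℝ) ^ 2) fun e he => by
      rw [he.followCounts_eq]; push_cast; rfl]
  simp only [followCounts, Finset.sum_const, smul_zero, Nat.cast_zero, zero_add, map_zero]
  rw [← followSeries, ← followStarSeries, ← countSeries, ← firstSeries, ← lastSeries]
  ring

lemma followStarSeries_eq : followStarSeries A = X * (C (Fintype.card A : ℝ) + followStarSeries A +
    2 * (followStarSeries A * (countSeries A - nonNullSeries A) +
      followSeries A * nonNullSeries A + lastSeries A * firstSeries A) +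
    2 * ((followStarSeries A - C ((Fintype.card A : ℝ) ^ 2) * absorbingSeries A) *
      (countSeries A - absorbingSeries A) +
      (lastSeries A - C (Fintype.card A : ℝ) * absorbingSeries A) *
      (firstSeries A - C (Fintype.card A : ℝ) * absorbingSeries A))) := by
  conv_lhs => rw [followStarSeries, costSeries_eq]
  have h1 : (fun l r : RegEx A => ((followCounts (cat l r)).2 : ℝ)) =
      fun l r => ((followCounts l).2 : ℝ) * (if nullable r then 1 else 0) +
        ((followCounts l).1 : ℝ) * (if nullable r then 0 else 1) +
        (if nullable l then 1 else 0) * ((followCounts r).2 : ℝ) +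
        (if nullable l then 0 else 1) * ((followCounts r).1 : ℝ) +
        numLast l * numFirst r + numFirst l * numLast r := by
    ext l r
    cases hl : nullable l <;> cases hr : nullable r <;> simp [followCounts, hl, hr] <;> ring
  have h2 : (fun l r : RegEx A => (1 - absorbing l) * (1 - absorbing r) *
      ((followCounts (plus l r)).2 : ℝ)) =
      fun l r => (1 - absorbing l) * ((followCounts l).2 : ℝ) * (1 - absorbing r) +
        (1 - absorbing l) * ((1 - absorbing r) * ((followCounts r).2 : ℝ)) +
        ((1 - absorbing l) * (numLast l : ℝ)) * ((1 - absorbing r) * (numFirst r : ℝ)) +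
        ((1 - absorbing l) * (numFirst l : ℝ)) * ((1 - absorbing r) * (numLast r : ℝ)) := by
    ext l r
    simp only [followCounts, Nat.cast_add, Nat.cast_mul]
    ring
  rw [h1, h2]
  simp only [pairSeries_add]
  rw [pairSeries_mul (fun e => ((followCounts e).2 : ℝ)) (fun e => if nullable e then 1 else 0),
    pairSeries_mul (fun e => ((followCounts e).1 : ℝ)) (fun e => if nullable e then 0 else 1),
    pairSeries_mul (fun e => if nullable e then 1 else 0) (fun e => ((followCounts e).2 : ℝ)),
    pairSeries_mul (fun e => if nullable e then 0 else 1) (fun e => ((followCounts e).1 : ℝ)),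
    pairSeries_mul (fun e => (numLast e : ℝ)) (fun e => (numFirst e : ℝ)),
    pairSeries_mul (fun e => (numFirst e : ℝ)) (fun e => (numLast e : ℝ)),
    pairSeries_mul (fun e => (1 - absorbing e) * ((followCounts e).2 : ℝ))
      (fun e => 1 - absorbing e),
    pairSeries_mul (fun e => 1 - absorbing e)
      (fun e => (1 - absorbing e) * ((followCounts e).2 : ℝ)),
    pairSeries_mul (fun e => (1 - absorbing e) * (numLast e : ℝ))
      (fun e => (1 - absorbing e) * (numFirst e : ℝ)),
    pairSeries_mul (fun e => (1 - absorbing e) * (numFirst e : ℝ))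
      (fun e => (1 - absorbing e) * (numLast e : ℝ)),
    costSeries_not_absorbing, costSeries_nullable,
    costSeries_not_absorbing_mul A (c := (Fintype.card A : ℝ) ^ 2) fun e he => by
      rw [he.followCounts_eq]; push_cast; rfl,
    costSeries_not_absorbing_mul A (c := Fintype.card A) fun e he => by rw [he.numLast_eq],
    costSeries_not_absorbing_mul A (c := Fintype.card A) fun e he => by rw [he.numFirst_eq]]
  simp only [followCounts, Finset.sum_const, Finset.card_univ, nsmul_eq_mul, mul_one, Nat.cast_one,
    Nat.cast_zero, zero_add]
  rw [← followSeries, ← followStarSeries, ← firstSeries, ← lastSeries, ← nonNullSeries]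
  ring

end RegEx

namespace RegEx

open PowerSeries

lemma card_avoids_mem {A B : Type} [Fintype A] (S : RegEx A → Set B) (hS : ∀ e, (S e).Finite)
    (n : ℕ) : Nat.card {p : RegEx A × B // Avoids p.1 ∧ size p.1 = n ∧ p.2 ∈ S p.1} =
      ∑ e ∈ avoiders A n, Nat.card (S e) := by
  have hfin : ∀ e : avoiders A n, Finite (S e.1) := fun e => (hS e.1).to_subtype
  let f : {p : RegEx A × B // Avoids p.1 ∧ size p.1 = n ∧ p.2 ∈ S p.1} ≃
      Σ e : avoiders A n, S e.1 :=
    { toFun := fun p => ⟨⟨p.1.1, (mem_avoiders A).2 ⟨p.2.1, p.2.2.1⟩⟩, ⟨p.1.2, p.2.2.2⟩⟩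
      invFun := fun q => ⟨(q.1.1, q.2.1), ((mem_avoiders A).1 q.1.2).1,
        ((mem_avoiders A).1 q.1.2).2, q.2.2⟩
      left_inv := fun _ => rfl
      right_inv := fun _ => rfl }
  rw [Nat.card_congr f, Nat.card_sigma]
  exact Finset.sum_coe_sort (avoiders A n) fun e => Nat.card (S e)

lemma coeff_countSeries (k n : ℕ) : coeff n (countSeries (Fin k)) = Rcount k n := by
  rw [countSeries, coeff_costSeries, Finset.sum_const, nsmul_eq_mul, mul_one, Rcount,
    ← Nat.card_eq_finsetCard]
  congr 1
  exact Nat.card_congr (Equiv.subtypeEquivRight fun e => mem_avoiders _)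

lemma coeff_firstSeries_add (k n : ℕ) :
    coeff n (firstSeries (Fin k) + followSeries (Fin k)) = Tcount k n := by
  rw [Tcount, card_avoids_mem _ finite_First, card_avoids_mem _ finite_Follow, map_add,
    firstSeries, followSeries, coeff_costSeries, coeff_costSeries]
  simp only [card_First, card_Follow]
  push_cast
  rfl

variable (A : Type) [Fintype A]

lemma coeff_nonNullSeries_le (n : ℕ) : coeff n (nonNullSeries A) ≤ coeff n (countSeries A) := by
  rw [nonNullSeries, coeff_costSeries, countSeries, coeff_costSeries]
  exact Finset.sum_le_sum fun e _ => by split_ifs <;> norm_num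

lemma coeff_absorbingSeries_nonneg (n : ℕ) : 0 ≤ coeff n (absorbingSeries A) := by
  rw [absorbingSeries, coeff_costSeries]
  exact Finset.sum_nonneg fun e _ => by rw [absorbing]; split_ifs <;> norm_num

lemma coeff_absorbingSeries_le (n : ℕ) :
    coeff n (absorbingSeries A) ≤ coeff n (countSeries A) := by
  rw [absorbingSeries, coeff_costSeries, countSeries, coeff_costSeries]
  exact Finset.sum_le_sum fun e _ => by rw [absorbing]; split_ifs <;> norm_num

lemma lastSeries_eq_firstSeries : lastSeries A = firstSeries A := by
  have h1 := firstSeries_eq A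
  have h2 := lastSeries_eq A
  have h : (lastSeries A - firstSeries A) * (1 - X * (1 + 2 * countSeries A - nonNullSeries A +
      2 * (countSeries A - absorbingSeries A))) = 0 := by
    linear_combination h2 - h1
  rcases mul_eq_zero.1 h with h | h
  · exact sub_eq_zero.1 h
  · have := congrArg (coeff 0) h
    simp at this

/-- A square root of the discriminant of the quadratic equation for the counting series. -/
noncomputable def rootSeries : ℝ⟦X⟧ :=
  1 - X + 2 * X * absorbingSeries A - 4 * X * countSeries A

lemma rootSeries_sq : rootSeries A ^ 2 = (1 - X + 2 * X * absorbingSeries A) ^ 2 -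
    8 * X ^ 2 * C (Fintype.card A + 1 : ℝ) - 8 * X ^ 2 * absorbingSeries A ^ 2 := by
  rw [rootSeries]
  linear_combination (-8 * X) * countSeries_eq A

lemma nonNullSeries_mul : nonNullSeries A * (1 - 2 * X * countSeries A) =
    X * C (Fintype.card A : ℝ) := by
  linear_combination nonNullSeries_eq A

lemma firstSeries_mul : firstSeries A * (rootSeries A + X * nonNullSeries A) =
    X * C (Fintype.card A : ℝ) * (1 - 2 * absorbingSeries A *
      (countSeries A - absorbingSeries A)) := by
  rw [rootSeries]
  linear_combination firstSeries_eq A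

lemma followSeries_mul : followSeries A *
    (rootSeries A * (rootSeries A + X + 2 * X * nonNullSeries A)) =
    X * (X * C (Fintype.card A : ℝ) - 2 * X * C ((Fintype.card A : ℝ) ^ 2) * absorbingSeries A *
        (countSeries A - absorbingSeries A) +
      2 * X * (firstSeries A - C (Fintype.card A : ℝ) * absorbingSeries A) ^ 2 +
      2 * X * firstSeries A ^ 2) +
    (X * firstSeries A ^ 2 - 2 * X * C ((Fintype.card A : ℝ) ^ 2) * absorbingSeries A *
      (countSeries A - absorbingSeries A)) * (rootSeries A + 2 * X * nonNullSeries A) := by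
  have h1 := followSeries_eq A
  have h2 := followStarSeries_eq A
  rw [lastSeries_eq_firstSeries] at h1 h2
  rw [rootSeries]
  linear_combination (1 - X + 2 * X * absorbingSeries A - 4 * X * countSeries A +
    2 * X * nonNullSeries A) * h1 + X * h2

lemma coeff_X_mul_derivative (f : ℝ⟦X⟧) (n : ℕ) :
    coeff n (X * derivative ℝ f) = n * coeff n f := by
  cases n with
  | zero => simp
  | succ n => rw [coeff_succ_X_mul, coeff_derivative]; push_cast; ring

lemma derivative_countSeries_mul : X * derivative ℝ (countSeries A) * rootSeries A =
    countSeries A - 4 * C (Fintype.card A : ℝ) * X * absorbingSeries A *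
      (countSeries A - absorbingSeries A) := by
  have h1 : X * derivative ℝ (absorbingSeries A) =
      2 * C (Fintype.card A : ℝ) * absorbingSeries A := by
    ext n
    rw [coeff_X_mul_derivative, absorbingSeries_eq, show (2 : ℝ⟦X⟧) = C 2 from rfl, ← map_mul,
      coeff_C_mul, coeff_C_mul, coeff_C_mul, coeff_X_pow]
    split_ifs with h
    · rw [h]; push_cast; ring
    · simp
  have h3 := countSeries_eq A
  have h2 := congrArg (derivative ℝ) h3
  simp only [Derivation.leibniz, Derivation.leibniz_pow, map_add, map_sub, derivative_X, derivative_C,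
    smul_eq_mul, nsmul_eq_mul] at h2
  rw [rootSeries]
  rw [map_add] at h3
  linear_combination X * h2 - h3 - 2 * X * (countSeries A - absorbingSeries A) * h1

end RegEx

lemma mul_pow_le_of_sq_le {k : ℕ} (hk : 1 ≤ k) {c t : ℝ} (hc : c ≤ 4 ^ (k - 1) * (k : ℝ) ^ k)
    (ht : t ^ 2 * (8 * (k + 1)) ≤ 1) : c * t ^ (2 * k) ≤ 1 / 4 * (1 / 2) ^ k := by
  have h1 : (4 : ℝ) ^ (k - 1) * (k : ℝ) ^ k = 1 / 4 * (4 * k) ^ k := by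
    obtain ⟨j, rfl⟩ : ∃ j, k = j + 1 := ⟨k - 1, by omega⟩
    rw [Nat.add_sub_cancel, mul_pow, pow_succ (4 : ℝ)]
    ring
  rw [h1] at hc
  calc c * t ^ (2 * k) ≤ 1 / 4 * (4 * k) ^ k * t ^ (2 * k) := by
        have : 0 ≤ t ^ (2 * k) := by rw [pow_mul]; positivity
        gcongr
    _ = 1 / 4 * (4 * k * t ^ 2) ^ k := by rw [mul_pow (4 * (k : ℝ)), ← pow_mul]; ring
    _ ≤ 1 / 4 * (1 / 2) ^ k := by
        gcongr
        nlinarith [sq_nonneg t]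

/-- The dominant singularity of the generating functions: the least positive root of the
discriminant of the quadratic equation satisfied by the counting series. -/
lemma exists_singularity {k : ℕ} (hk : 2 ≤ k) {c : ℝ} (hc0 : 0 ≤ c)
    (hc : c ≤ 4 ^ (k - 1) * (k : ℝ) ^ k) :
    ∃ t : ℝ, 0 < t ∧ t ^ 2 * (8 * (k + 1)) < 1 ∧
      (1 - t + 2 * t * (c * t ^ (2 * k))) ^ 2 =
        8 * t ^ 2 * (k + 1) + 8 * t ^ 2 * (c * t ^ (2 * k)) ^ 2 := by
  set d : ℝ → ℝ := fun t => (1 - t + 2 * t * (c * t ^ (2 * k))) ^ 2 -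
    (8 * t ^ 2 * (k + 1) + 8 * t ^ 2 * (c * t ^ (2 * k)) ^ 2) with hd
  set s : ℝ := (√(8 * (k + 1)))⁻¹ with hs
  have hs0 : 0 < s := by positivity
  have hs2 : s ^ 2 * (8 * (k + 1)) = 1 := by
    rw [hs, inv_pow, Real.sq_sqrt (by positivity)]
    exact inv_mul_cancel₀ (by positivity)
  have hk' : (2 : ℝ) ≤ k := by exact_mod_cast hk
  have hs1 : s < 1 := by nlinarith
  have hx0 : 0 ≤ c * s ^ (2 * k) := by positivity
  have hx1 : c * s ^ (2 * k) ≤ 1 / 4 := by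
    refine (mul_pow_le_of_sq_le (by omega) hc hs2.le).trans ?_
    have : ((1 : ℝ) / 2) ^ k ≤ 1 := pow_le_one₀ (by norm_num) (by norm_num)
    linarith
  have hds : d s < 0 := by
    simp only [hd]
    set x := c * s ^ (2 * k)
    have h1 : 0 ≤ s * x := by positivity
    have h2 : s * x ≤ s * (1 / 4) := by gcongr
    have h3 : 0 ≤ (s * x) ^ 2 := by positivity
    nlinarith
  have hd0 : d 0 = 1 := by simp [hd]
  have hcont : ContinuousOn d (Icc 0 s) := by
    apply Continuous.continuousOn
    fun_prop
  obtain ⟨t, ⟨ht0, hts⟩, ht⟩ := intermediate_value_Icc' hs0.le hcont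
    (show (0 : ℝ) ∈ Icc (d s) (d 0) from ⟨hds.le, by rw [hd0]; norm_num⟩)
  refine ⟨t, lt_of_le_of_ne ht0 ?_, ?_, sub_eq_zero.1 ht⟩
  · rintro rfl
    rw [hd0] at ht
    norm_num at ht
  · have hlt : t < s := lt_of_le_of_ne hts fun h => by
      rw [h] at ht
      exact hds.ne ht
    have : t ^ 2 < s ^ 2 := by gcongr
    nlinarith

open Polynomial in
/-- The quotient by `1 - X` of the rescaled discriminant. -/
noncomputable def discrQuotient (k : ℕ) (t x : ℝ) : ℝ[X] :=
  C (2 * t) + C ((8 * k + 7) * t ^ 2) * (1 + X)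
    - C (4 * t * x) * ∑ i ∈ Finset.range (2 * k + 1), X ^ i
    + C (4 * t ^ 2 * x) * ∑ i ∈ Finset.range (2 * k + 2), X ^ i
    + C (4 * t ^ 2 * x ^ 2) * ∑ i ∈ Finset.range (4 * k + 2), X ^ i

lemma norm_geom_sum_le_of_norm_le_one {z : ℂ} (hz : ‖z‖ ≤ 1) (n : ℕ) :
    ‖∑ i ∈ Finset.range n, z ^ i‖ ≤ n := by
  refine (norm_sum_le _ _).trans ((Finset.sum_le_card_nsmul _ _ 1 fun i _ => ?_).trans (by simp))
  rw [norm_pow]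
  exact pow_le_one₀ (norm_nonneg _) hz

lemma re_eval_discrQuotient_pos {k : ℕ} (hk : 2 ≤ k) {t x : ℝ} (ht : 0 < t) (ht' : t ≤ 1 / 4)
    (hx : 0 ≤ x) (hx' : x * (2 * k + 1) ≤ 5 / 16) {z : ℂ} (hz : ‖z‖ ≤ 1) :
    0 < (((discrQuotient k t x).map Complex.ofRealHom).eval z).re := by
  have hk' : (2 : ℝ) ≤ k := by exact_mod_cast hk
  have hb (n : ℕ) : |(∑ i ∈ Finset.range n, z ^ i).re| ≤ n :=
    (Complex.abs_re_le_norm _).trans (norm_geom_sum_le_of_norm_le_one hz n)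
  have hzr : -1 ≤ z.re := by
    have := (abs_le.1 ((Complex.abs_re_le_norm z).trans hz)).1
    exact this
  have h1 := (abs_le.1 (hb (2 * k + 1))).2
  have h2 := (abs_le.1 (hb (2 * k + 2))).1
  have h3 := (abs_le.1 (hb (4 * k + 2))).1
  push_cast at h1 h2 h3
  have key : (((discrQuotient k t x).map Complex.ofRealHom).eval z).re =
      2 * t + (8 * k + 7) * t ^ 2 * (1 + z.re)
      - 4 * t * x * (∑ i ∈ Finset.range (2 * k + 1), z ^ i).re
      + 4 * t ^ 2 * x * (∑ i ∈ Finset.range (2 * k + 2), z ^ i).re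
      + 4 * t ^ 2 * x ^ 2 * (∑ i ∈ Finset.range (4 * k + 2), z ^ i).re := by
    simp only [discrQuotient, Polynomial.map_add, Polynomial.map_sub, Polynomial.map_mul,
      Polynomial.map_C, Polynomial.map_one, Polynomial.map_X, Polynomial.map_sum,
      Polynomial.map_pow, Polynomial.eval_add, Polynomial.eval_sub, Polynomial.eval_mul,
      Polynomial.eval_C, Polynomial.eval_one, Polynomial.eval_X, Polynomial.eval_finsetSum,
      Polynomial.eval_pow, Complex.ofRealHom_eq_coe, Complex.add_re, Complex.sub_re,
      Complex.re_ofReal_mul, Complex.ofReal_re, Complex.one_re]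
  rw [key]
  have hx1 : x ≤ 1 / 16 := by nlinarith
  have e0 : 0 ≤ (8 * (k : ℝ) + 7) * t ^ 2 * (1 + z.re) :=
    mul_nonneg (by positivity) (by linarith)
  have e1 : 4 * t * x * (∑ i ∈ Finset.range (2 * k + 1), z ^ i).re ≤ 4 * t * (5 / 16) :=
    calc _ ≤ 4 * t * x * (2 * k + 1) := by gcongr
      _ = 4 * t * (x * (2 * k + 1)) := by ring
      _ ≤ _ := by gcongr
  have e2 : -(4 * t * (1 / 4) * (3 / 8)) ≤
      4 * t ^ 2 * x * (∑ i ∈ Finset.range (2 * k + 2), z ^ i).re :=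
    calc -(4 * t * (1 / 4) * (3 / 8)) ≤ -(4 * t * t * (x * (2 * k + 2))) := by
          rw [neg_le_neg_iff]
          gcongr
          nlinarith
      _ = 4 * t ^ 2 * x * (-(2 * k + 2)) := by ring
      _ ≤ _ := by gcongr
  have e3 : -(4 * t * (1 / 4) * (1 / 16) * (5 / 8)) ≤
      4 * t ^ 2 * x ^ 2 * (∑ i ∈ Finset.range (4 * k + 2), z ^ i).re :=
    calc -(4 * t * (1 / 4) * (1 / 16) * (5 / 8)) ≤ -(4 * t * t * x * (x * (4 * k + 2))) := by
          rw [neg_le_neg_iff]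
          gcongr
          nlinarith
      _ = 4 * t ^ 2 * x ^ 2 * (-(4 * k + 2)) := by ring
      _ ≤ _ := by gcongr
  linarith

open PowerSeries in
lemma one_sub_X_mul_discrQuotient {k : ℕ} {t x : ℝ}
    (h : (1 - t + 2 * t * x) ^ 2 = 8 * t ^ 2 * (k + 1) + 8 * t ^ 2 * x ^ 2) :
    (1 - X) * (discrQuotient k t x : ℝ⟦X⟧) =
      (1 - C t * X + 2 * (C t * X) * (C x * X ^ (2 * k))) ^ 2
        - 8 * (C t * X) ^ 2 * C (k + 1 : ℝ) - 8 * (C t * X) ^ 2 * (C x * X ^ (2 * k)) ^ 2 := by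
  have hg (n : ℕ) := mul_neg_geom_sum (X : ℝ⟦X⟧) n
  have hc := congrArg (C : ℝ →+* ℝ⟦X⟧) h
  have hcoe : (discrQuotient k t x : ℝ⟦X⟧) =
      C (2 * t) + C ((8 * k + 7) * t ^ 2) * (1 + X)
    - C (4 * t * x) * ∑ i ∈ Finset.range (2 * k + 1), X ^ i
    + C (4 * t ^ 2 * x) * ∑ i ∈ Finset.range (2 * k + 2), X ^ i
    + C (4 * t ^ 2 * x ^ 2) * ∑ i ∈ Finset.range (4 * k + 2), X ^ i := by
    have hs (n : ℕ) : ((∑ i ∈ Finset.range n, Polynomial.X ^ i : Polynomial ℝ) : ℝ⟦X⟧) =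
        ∑ i ∈ Finset.range n, X ^ i := by
      rw [← Polynomial.coeToPowerSeries.ringHom_apply, map_sum]
      simp
    rw [discrQuotient]
    simp [-map_mul, hs]
  rw [hcoe]
  simp only [map_mul, map_add, map_sub, map_pow, map_one, map_ofNat] at hc ⊢
  linear_combination -hc - 4 * C t * C x * hg (2 * k + 1) + 4 * C t ^ 2 * C x * hg (2 * k + 2)
    + 4 * C t ^ 2 * C x ^ 2 * hg (4 * k + 2)

namespace PowerSeries

lemma coeff_mul_nonneg {f g : ℝ⟦X⟧} (hf : ∀ n, 0 ≤ coeff n f) (hg : ∀ n, 0 ≤ coeff n g) (n : ℕ) :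
    0 ≤ coeff n (f * g) := by
  rw [coeff_mul]
  exact Finset.sum_nonneg fun p _ => mul_nonneg (hf _) (hg _)

lemma coeff_C_mul_X_mul_nonneg {t : ℝ} (ht : 0 ≤ t) {f : ℝ⟦X⟧} (hf : ∀ n, 0 ≤ coeff n f) (n : ℕ) :
    0 ≤ coeff n (C t * X * f) := by
  refine coeff_mul_nonneg (fun i => ?_) hf n
  rw [coeff_C_mul, coeff_X]
  split_ifs <;> simp [ht]

/-- The ratio of the coefficients of two series with a common square-root singularity at `1`
and no other singularity on the unit circle. -/
lemma tendsto_coeff_div_coeff {w A F E Y : ℝ⟦X⟧} {v a b c : ℝ} (hA : HasDecaySum A v)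
    (hv : v ≠ 0) (hwA : w * (A * invSqrt) = 1) (hF : HasDecaySum F a)
    (hE : HasDecaySum (E * w) b) (hY : HasDecaySum (Y * w) c) (hc : c ≠ 0) :
    Tendsto (fun n => coeff n (F + E) / coeff n Y) atTop (nhds (b / c)) := by
  have eE : E = E * w * A * invSqrt := by linear_combination (-E) * hwA
  have eY : Y = Y * w * A * invSqrt := by linear_combination (-Y) * hwA
  have h1 := (hE.mul hA).tendsto_coeff_mul_invSqrt_div
  have h2 := (hY.mul hA).tendsto_coeff_mul_invSqrt_div
  rw [← eE] at h1
  rw [← eY] at h2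
  have h3 := (hF.tendsto_coeff_div.add h1).div h2 (mul_ne_zero hc hv)
  rw [zero_add, mul_div_mul_right _ _ hv] at h3
  refine h3.congr fun n => ?_
  have := invSqrtCoeff_pos n
  rw [map_add, Pi.div_apply, ← add_div]
  exact div_div_div_cancel_right₀ this.ne' _ _

lemma HasDecaySum.of_mul_one_sub_C_mul_X_mul {t g b : ℝ} {f G B : ℝ⟦X⟧} (ht : 0 ≤ t)
    (hG : HasDecaySum G g) (hG0 : ∀ n, 0 ≤ coeff n G) (htg : t * g < 1) (hB : HasDecaySum B b)
    (h : f * (1 - C t * X * G) = B) : HasDecaySum f (b / (1 - t * g)) := by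
  refine HasDecaySum.of_mul_one_sub (V := C t * X * G) ?_ (coeff_C_mul_X_mul_nonneg ht hG0) ?_
    htg hB h
  · simpa using ((hasDecaySum_C t).mul hasDecaySum_X).mul hG
  · simp [mul_assoc]

lemma exists_tendsto_coeff_div {k : ℕ} {κ t x : ℝ} {S R M F E Y w : ℝ⟦X⟧} {q : Polynomial ℝ}
    (hS : S = C x * X ^ (2 * k))
    (hw : w = 1 - C t * X + 2 * (C t * X) * S - 4 * (C t * X) * R)
    (hw2 : w ^ 2 = (1 - X) * (q : ℝ⟦X⟧))
    (hq : ∀ z : ℂ, ‖z‖ ≤ 1 → 0 < ((q.map Complex.ofRealHom).eval z).re)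
    (hM : M * (1 - 2 * (C t * X) * R) = C t * X * C κ)
    (hF : F * (w + C t * X * M) = C t * X * C κ * (1 - 2 * S * (R - S)))
    (hE : E * (w * (w + C t * X + 2 * (C t * X) * M)) =
      C t * X * (C t * X * C κ - 2 * (C t * X) * C (κ ^ 2) * S * (R - S)
        + 2 * (C t * X) * (F - C κ * S) ^ 2 + 2 * (C t * X) * F ^ 2)
      + (C t * X * F ^ 2 - 2 * (C t * X) * C (κ ^ 2) * S * (R - S)) *
        (w + 2 * (C t * X) * M))
    (hY : Y * w = R - 4 * C κ * (C t * X) * S * (R - S))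
    (hMR : ∀ n, coeff n M ≤ coeff n R)
    (hS0 : ∀ n, 0 ≤ coeff n S) (hSR : ∀ n, coeff n S ≤ coeff n R)
    (ht : 0 < t) (ht' : t ≤ 1 / 4) (hx : 0 ≤ x) (hx' : x ≤ 1 / 16) (hκ : 0 < κ)
    (hκx : 4 * κ * t * x ≤ 1 / 4) :
    ∃ r m f : ℝ, 4 * t * r = 1 - t + 2 * t * x ∧ m * (1 - 2 * t * r) = κ * t ∧
      f * (t * m) = κ * t * (1 - 2 * x * (r - x)) ∧
      Tendsto (fun n => coeff n (F + E) / coeff n Y) atTop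
        (nhds ((t * (t * κ - 2 * t * κ ^ 2 * x * (r - x) + 2 * t * (f - κ * x) ^ 2 + 2 * t * f ^ 2)
          + (t * f ^ 2 - 2 * t * κ ^ 2 * x * (r - x)) * (2 * t * m)) / (t + 2 * t * m) /
          (r - 4 * κ * t * x * (r - x)))) := by
  obtain ⟨dw, A, v, dA, hv, hwA⟩ := exists_inv_of_sq_eq hq hw2
  have dZ : HasDecaySum (C t * X) t := by simpa using (hasDecaySum_C t).mul hasDecaySum_X
  have dκ := hasDecaySum_C κ
  have dκ2 := hasDecaySum_C (κ ^ 2)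
  have d1 := hasDecaySum_one
  have d2 := hasDecaySum_ofNat 2
  have d4 := hasDecaySum_ofNat 4
  have dS : HasDecaySum S x := by
    rw [hS]
    simpa using (hasDecaySum_C x).mul (hasDecaySum_X.pow (2 * k))
  set r := (1 - t + 2 * t * x) / (4 * t) with hr
  have hr1 : 4 * t * r = 1 - t + 2 * t * x := by rw [hr]; field_simp
  have dR : HasDecaySum R r := by
    apply HasDecaySum.of_X_mul
    have h1 := (hasDecaySum_C (1 / (4 * t))).mul
      (((d1.sub dZ).add ((d2.mul dZ).mul dS)).sub dw)
    have h2 : C (1 / (4 * t)) * (1 - C t * X + 2 * (C t * X) * S - w) = X * R := by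
      have h3 : C (1 / (4 * t)) * (4 * C t) = (1 : ℝ⟦X⟧) := by
        have : (4 : ℝ⟦X⟧) = C 4 := rfl
        rw [this, ← map_mul, ← map_mul, one_div_mul_cancel (by positivity), map_one]
      rw [hw]
      linear_combination X * R * h3
    have h4 : 1 / (4 * t) * (1 - t + 2 * t * x - 0) = r := by rw [hr]; ring
    have h5 : HasDecaySum (C (1 / (4 * t)) * (1 - C t * X + 2 * (C t * X) * S - w))
      (1 / (4 * t) * (1 - t + 2 * t * x - 0)) := h1
    rwa [h2, h4] at h5
  have hR0 : ∀ n, 0 ≤ coeff n R := fun n => (hS0 n).trans (hSR n)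
  have hRS0 : ∀ n, 0 ≤ coeff n (R - S) := fun n => by
    rw [map_sub]; exact sub_nonneg.2 (hSR n)
  have hRM0 : ∀ n, 0 ≤ coeff n (R - M) := fun n => by
    rw [map_sub]; exact sub_nonneg.2 (hMR n)
  have hadd {f g : ℝ⟦X⟧} (hf : ∀ n, 0 ≤ coeff n f) (hg : ∀ n, 0 ≤ coeff n g) (n : ℕ) :
      0 ≤ coeff n (f + g) := by
    rw [map_add]; exact add_nonneg (hf n) (hg n)
  have hone : ∀ n, 0 ≤ coeff n (1 : ℝ⟦X⟧) := fun n => by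
    rw [coeff_one]; split_ifs <;> norm_num
  have h2tr : 2 * t * r < 1 := by nlinarith
  have hκt : 0 < κ * t := by positivity
  set m := κ * t / (1 - 2 * t * r) with hm
  have hm0 : 0 < m := div_pos hκt (by linarith)
  have hm1 : m * (1 - 2 * t * r) = κ * t := div_mul_cancel₀ _ (by linarith)
  have htm : 0 < t * m := by positivity
  have dM : HasDecaySum M m := by
    have := HasDecaySum.of_mul_one_sub_C_mul_X_mul ht.le (dR.add dR) (hadd hR0 hR0)
      (by linarith) (dZ.mul dκ) (f := M) (by rw [← hM]; ring)
    convert this using 1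
    rw [hm]; ring_nf
  set f := κ * t * (1 - 2 * x * (r - x)) / (t * m) with hf
  have hf1 : f * (t * m) = κ * t * (1 - 2 * x * (r - x)) := div_mul_cancel₀ _ htm.ne'
  have dF : HasDecaySum F f := by
    have := HasDecaySum.of_mul_one_sub_C_mul_X_mul ht.le
      ((((d1.add (dR.sub dS)).add (dR.sub dS)).add dR).add (dR.sub dM))
      (hadd (hadd (hadd (hadd hone hRS0) hRS0) hR0) hRM0) (by linarith)
      ((dZ.mul dκ).mul (d1.sub ((d2.mul dS).mul (dR.sub dS)))) (f := F)
      (by rw [← hF, hw]; ring)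
    convert this using 1
    rw [hf]
    congr 1
    · ring
    · linarith
  have dE := HasDecaySum.of_mul_one_sub_C_mul_X_mul ht.le
      ((((dR.sub dS).add (dR.sub dS)).add (dR.sub dM)).add (dR.sub dM))
      (hadd (hadd (hadd hRS0 hRS0) hRM0) hRM0) (by linarith)
      ((dZ.mul ((((dZ.mul dκ).sub ((((d2.mul dZ).mul dκ2).mul dS).mul (dR.sub dS))).add
        ((d2.mul dZ).mul ((dF.sub (dκ.mul dS)).pow 2))).add ((d2.mul dZ).mul (dF.pow 2)))).add
        (((dZ.mul (dF.pow 2)).sub ((((d2.mul dZ).mul dκ2).mul dS).mul (dR.sub dS))).mul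
        (dw.add ((d2.mul dZ).mul dM)))) (f := E * w) (by rw [← hE, hw]; ring)
  have dY := dR.sub ((((d4.mul dκ).mul dZ).mul dS).mul (dR.sub dS))
  rw [← hY] at dY
  have hrx : 0 ≤ r - x := by nlinarith
  have hden : r - 4 * κ * t * x * (r - x) ≠ 0 := by
    have : 4 * κ * t * x * (r - x) ≤ 1 / 4 * (r - x) := by gcongr
    nlinarith
  refine ⟨r, m, f, hr1, hm1, hf1, ?_⟩
  convert tendsto_coeff_div_coeff dA hv hwA dF dE dY hden using 3
  congr 1
  · ring
  · linarith

lemma rescale_C (a b : ℝ) : rescale a (C b) = C b := by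
  ext n
  rw [coeff_rescale, coeff_C]
  split_ifs with h <;> simp [h]

end PowerSeries

namespace RegEx

open PowerSeries

/-- The value of `λ_k` in terms of the singularity `t` and of the values at the singularity
of the generating functions. -/
noncomputable def transitionRate (κ t x r m f : ℝ) : ℝ :=
  (t * (t * κ - 2 * t * κ ^ 2 * x * (r - x) + 2 * t * (f - κ * x) ^ 2 + 2 * t * f ^ 2)
    + (t * f ^ 2 - 2 * t * κ ^ 2 * x * (r - x)) * (2 * t * m)) / (t + 2 * t * m) /
    (r - 4 * κ * t * x * (r - x))

lemma five_div_four_mul_two_pow {k : ℕ} (hk : 2 ≤ k) : (2 * k + 1 : ℝ) ≤ 5 / 4 * 2 ^ k := by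
  induction k, hk using Nat.le_induction with
  | base => norm_num
  | succ k hk ih =>
    have : (2 : ℝ) ≤ k := by exact_mod_cast hk
    push_cast
    rw [pow_succ]
    linarith

lemma exists_tendsto_transitions {k : ℕ} (hk : 2 ≤ k) :
    ∃ t x r m f : ℝ, 0 < t ∧ t ^ 2 * (8 * (k + 1)) < 1 ∧ 0 ≤ x ∧ x ≤ 1 / 4 * (1 / 2) ^ k ∧
      (1 - t + 2 * t * x) ^ 2 = 8 * t ^ 2 * (k + 1) + 8 * t ^ 2 * x ^ 2 ∧
      4 * t * r = 1 - t + 2 * t * x ∧ m * (1 - 2 * t * r) = k * t ∧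
      f * (t * m) = k * t * (1 - 2 * x * (r - x)) ∧
      Tendsto (fun n : ℕ => (Tcount k n : ℝ) / ((n : ℝ) * (Rcount k n : ℝ))) atTop
        (nhds (transitionRate k t x r m f)) := by
  have hk' : (2 : ℝ) ≤ k := by exact_mod_cast hk
  set c : ℝ := (numSigmaStar (Fin k) : ℝ) with hc
  have hc0 : 0 ≤ c := Nat.cast_nonneg _
  have hc1 : c ≤ 4 ^ (k - 1) * (k : ℝ) ^ k := by
    have := numSigmaStar_le (A := Fin k)
    rw [Fintype.card_fin] at this
    rw [hc]
    exact_mod_cast this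
  obtain ⟨t, ht, ht2, hdisc⟩ := exists_singularity hk hc0 hc1
  set x := c * t ^ (2 * k) with hx
  have hx0 : 0 ≤ x := by positivity
  have hx1 : x ≤ 1 / 4 * (1 / 2) ^ k := mul_pow_le_of_sq_le (by omega) hc1 ht2.le
  have ht4 : t ≤ 1 / 4 := by nlinarith
  have hxk : x * (2 * k + 1) ≤ 5 / 16 := by
    calc x * (2 * k + 1) ≤ 1 / 4 * (1 / 2) ^ k * (5 / 4 * 2 ^ k) :=
          mul_le_mul hx1 (five_div_four_mul_two_pow hk) (by positivity) (by positivity)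
      _ = 5 / 16 * (1 / 2 * 2) ^ k := by rw [mul_pow]; ring
      _ = 5 / 16 := by norm_num
  have hS : rescale t (absorbingSeries (Fin k)) = C x * X ^ (2 * k) := by
    rw [absorbingSeries_eq, Fintype.card_fin, map_mul, map_pow, rescale_C, rescale_X, mul_pow,
      ← map_pow, ← mul_assoc, ← map_mul]
  have hw : rescale t (rootSeries (Fin k)) =
      1 - C t * X + 2 * (C t * X) * rescale t (absorbingSeries (Fin k))
        - 4 * (C t * X) * rescale t (countSeries (Fin k)) := by
    simp only [rootSeries, map_mul, map_add, map_sub, map_one, map_ofNat, rescale_X]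
  have hw2 := congrArg (rescale t) (rootSeries_sq (Fin k))
  have hM := congrArg (rescale t) (nonNullSeries_mul (Fin k))
  have hF := congrArg (rescale t) (firstSeries_mul (Fin k))
  have hE := congrArg (rescale t) (followSeries_mul (Fin k))
  have hY := congrArg (rescale t) (derivative_countSeries_mul (Fin k))
  rw [map_mul (rescale t) (X * _)] at hY
  set Y := rescale t (X * derivative ℝ (countSeries (Fin k))) with hYdef
  simp only [map_mul, map_add, map_sub, map_pow, map_one, map_ofNat, rescale_X, rescale_C,
    Fintype.card_fin] at hw2 hM hF hE hY
  have hcoeff {f g : ℝ⟦X⟧} (h : ∀ n, coeff n f ≤ coeff n g) (n : ℕ) :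
      coeff n (rescale t f) ≤ coeff n (rescale t g) := by
    rw [coeff_rescale, coeff_rescale]
    exact mul_le_mul_of_nonneg_left (h n) (pow_nonneg ht.le n)
  obtain ⟨r, m, f, h1, h2, h3, h4⟩ := exists_tendsto_coeff_div (k := k) (κ := k) (t := t) (x := x)
    (q := discrQuotient k t x) (Y := Y)
    (E := rescale t (followSeries (Fin k))) hS hw
    (by
      rw [one_sub_X_mul_discrQuotient hdisc, hw2, hS]
      simp only [map_add, map_one])
    (fun z hz => re_eval_discrQuotient_pos hk ht ht4 hx0 hxk hz)
    (hM.trans (by simp)) hF (by rw [map_pow]; linear_combination hE) (by linear_combination hY)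
    (hcoeff (coeff_nonNullSeries_le _))
    (fun n => by simpa using hcoeff (f := 0) (by simpa using coeff_absorbingSeries_nonneg _) n)
    (hcoeff (coeff_absorbingSeries_le _)) ht ht4 hx0 (by nlinarith) (by linarith) (by nlinarith)
  refine ⟨t, x, r, m, f, ht, ht2, hx0, hx1, hdisc, h1, h2, h3, h4.congr fun n => ?_⟩
  rw [← map_add, coeff_rescale, coeff_firstSeries_add, hYdef, coeff_rescale,
    coeff_X_mul_derivative, coeff_countSeries]
  exact mul_div_mul_left _ _ (pow_ne_zero _ ht.ne')

end RegEx

namespace RegEx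

lemma transitionRate_eq {κ t x r m f : ℝ} (ht : t ≠ 0) :
    transitionRate κ t x r m f =
      (t * (t ^ 2 * κ - 2 * (κ ^ 2 * x) * t * (t * r - t * x) + 2 * (t * f - κ * x * t) ^ 2
          + 2 * (t * f) ^ 2)
        + ((t * f) ^ 2 - 2 * (κ ^ 2 * x) * t * (t * r - t * x)) * (2 * (t * m))) /
          (t + 2 * (t * m)) / (t * r - 4 * (κ * x) * t * (t * r - t * x)) := by
  have h1 : t * r - 4 * (κ * x) * t * (t * r - t * x) =
      t * (r - 4 * κ * t * x * (r - x)) := by ring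
  rw [transitionRate, h1, ← mul_div_mul_left _ (r - 4 * κ * t * x * (r - x)) ht, ← mul_div_assoc]
  congr 2
  · ring
  · ring

lemma tendsto_transitionRate {t x r m f : ℕ → ℝ} (ht : ∀ k, 2 ≤ k → 0 < t k)
    (ht2 : ∀ k : ℕ, 2 ≤ k → t k ^ 2 * (8 * (k + 1)) < 1) (hx : ∀ k, 2 ≤ k → 0 ≤ x k)
    (hx2 : ∀ k, 2 ≤ k → x k ≤ 1 / 4 * (1 / 2) ^ k)
    (hd : ∀ k : ℕ, 2 ≤ k → (1 - t k + 2 * t k * x k) ^ 2 =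
      8 * t k ^ 2 * (k + 1) + 8 * t k ^ 2 * x k ^ 2)
    (hr : ∀ k, 2 ≤ k → 4 * t k * r k = 1 - t k + 2 * t k * x k)
    (hm : ∀ k : ℕ, 2 ≤ k → m k * (1 - 2 * t k * r k) = k * t k)
    (hf : ∀ k : ℕ, 2 ≤ k → f k * (t k * m k) = k * t k * (1 - 2 * x k * (r k - x k))) :
    Tendsto (fun k : ℕ => transitionRate k (t k) (x k) (r k) (m k) (f k)) atTop (nhds 1) := by
  have hev {P : ℕ → Prop} (h : ∀ k, 2 ≤ k → P k) : ∀ᶠ k in atTop, P k :=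
    (eventually_ge_atTop 2).mono h
  have lk2x : Tendsto (fun k : ℕ => (k : ℝ) ^ 2 * x k) atTop (nhds 0) := by
    have h := (tendsto_pow_const_mul_const_pow_of_lt_one 2 (r := (1 / 2 : ℝ)) (by norm_num)
      (by norm_num)).const_mul (1 / 4)
    rw [mul_zero] at h
    refine squeeze_zero' (hev fun k hk => mul_nonneg (by positivity) (hx k hk))
      (hev fun k hk => ?_) h
    calc (k : ℝ) ^ 2 * x k ≤ (k : ℝ) ^ 2 * (1 / 4 * (1 / 2) ^ k) := by gcongr; exact hx2 k hk
      _ = _ := by ring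
  have lkx : Tendsto (fun k : ℕ => (k : ℝ) * x k) atTop (nhds 0) := by
    refine squeeze_zero' (hev fun k hk => mul_nonneg (by positivity) (hx k hk))
      (hev fun k hk => ?_) lk2x
    have : (2 : ℝ) ≤ k := by exact_mod_cast hk
    have := hx k hk
    gcongr
    nlinarith
  have lx : Tendsto x atTop (nhds 0) := by
    refine squeeze_zero' (hev hx) (hev fun k hk => ?_) lkx
    have : (2 : ℝ) ≤ k := by exact_mod_cast hk
    nlinarith [hx k hk]
  have lt2 : Tendsto (fun k => t k ^ 2) atTop (nhds 0) := by
    refine squeeze_zero' (hev fun k hk => by positivity) (hev fun k hk => ?_)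
      (tendsto_one_div_add_atTop_nhds_zero_nat (𝕜 := ℝ))
    rw [le_div_iff₀ (by positivity)]
    have := ht2 k hk
    have h0 : 0 ≤ t k ^ 2 * (k + 1) := by positivity
    linarith
  have lt : Tendsto t atTop (nhds 0) := by
    have h := lt2.sqrt
    rw [Real.sqrt_zero] at h
    exact h.congr' (hev fun k hk => Real.sqrt_sq (ht k hk).le)
  have lp : Tendsto (fun k : ℕ => t k ^ 2 * k) atTop (nhds (1 / 8)) := by
    have h := (((((lt.const_sub 1).add ((lt.const_mul 2).mul lx)).pow 2).sub
      ((lt2.const_mul 8).mul (lx.pow 2))).div_const 8).sub lt2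
    norm_num at h
    norm_num
    exact h.congr' (hev fun k hk => by linear_combination (1 / 8) * hd k hk)
  have lρ : Tendsto (fun k => t k * r k) atTop (nhds (1 / 4)) := by
    have h := ((lt.const_sub 1).add ((lt.const_mul 2).mul lx)).div_const 4
    norm_num at h
    norm_num
    exact h.congr' (hev fun k hk => by linear_combination (-1 / 4) * hr k hk)
  have hpos (k : ℕ) (hk : 2 ≤ k) : 0 < t k ^ 2 * k := by
    have := ht k hk
    have : (0 : ℝ) < k := by exact_mod_cast (by omega : 0 < k)
    positivity
  have hm' (k : ℕ) (hk : 2 ≤ k) : t k * m k * (1 - 2 * (t k * r k)) = t k ^ 2 * k := by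
    linear_combination t k * hm k hk
  have lμ : Tendsto (fun k => t k * m k) atTop (nhds (1 / 4)) := by
    have h := lp.div ((lρ.const_mul 2).const_sub 1) (by norm_num)
    norm_num at h
    norm_num
    refine h.congr' (hev fun k hk => ?_)
    rw [Pi.div_apply, ← hm' k hk]
    refine mul_div_cancel_right₀ _ fun h0 => (hpos k hk).ne' ?_
    rw [← hm' k hk, h0, mul_zero]
  have lxr : Tendsto (fun k => x k * r k) atTop (nhds 0) := by
    have h := ((lkx.mul lt).mul lρ).div lp (by norm_num)
    norm_num at h
    refine h.congr' (hev fun k hk => ?_)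
    rw [Pi.div_apply, div_eq_iff (hpos k hk).ne']
    ring
  have lφ : Tendsto (fun k => t k * f k) atTop (nhds (1 / 2)) := by
    have h := (lp.mul (((lxr.sub (lx.pow 2)).const_mul 2).const_sub 1)).div lμ (by norm_num)
    norm_num at h
    norm_num
    refine h.congr' (hev fun k hk => ?_)
    have h0 : t k * m k ≠ 0 := fun h0 => (hpos k hk).ne' (by rw [← hm' k hk, h0, zero_mul])
    rw [Pi.div_apply, div_eq_iff h0]
    linear_combination (-t k) * hf k hk
  have lc := ((lk2x.const_mul 2).mul lt).mul (lρ.sub (lt.mul lx))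
  have h := (((lt.mul (((lp.sub lc).add (((lφ.sub (lkx.mul lt)).pow 2).const_mul 2)).add
    ((lφ.pow 2).const_mul 2))).add (((lφ.pow 2).sub lc).mul (lμ.const_mul 2))).div
    (lt.add (lμ.const_mul 2)) (by norm_num)).div
    (lρ.sub (((lkx.const_mul 4).mul lt).mul (lρ.sub (lt.mul lx)))) (by norm_num)
  norm_num at h
  refine h.congr' (hev fun k hk => ?_)
  exact (transitionRate_eq (ht k hk).ne').symm

end RegEx

/-- For each integer `k ≥ 2` there is a real constant `λ_k` with
`t_n/(n·R_n) → λ_k` as `n → ∞`, and `lim_{k→∞} λ_k = 1`: the number of transitions of the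
Glushkov automaton of a uniformly random expression of `REna` of size `n` is asymptotically
`λ_k·n`, with `λ_k` tending to `1` as the alphabet size grows. -/
theorem statement19 :
    ∃ lam : ℕ → ℝ,
      (∀ k, 2 ≤ k →
        Tendsto (fun n : ℕ => (Tcount k n : ℝ) / ((n : ℝ) * (Rcount k n : ℝ)))
          atTop (nhds (lam k))) ∧
      Tendsto lam atTop (nhds 1) := by
  choose! t x r m f ht ht2 hx hx2 hd hr hm hf hlim using
    fun (k : ℕ) (hk : 2 ≤ k) => RegEx.exists_tendsto_transitions hk
  exact ⟨_, hlim, RegEx.tendsto_transitionRate ht ht2 hx hx2 hd hr hm hf⟩
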